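/- Let m, p be positive integers, let A_1, ..., A_m be p×p complex Hermitian matrices, and let γ_1 ≥ ... ≥ γ_{mp} be the combined list of the eigenvalues (with multiplicities) of A_1, ..., A_m, arranged in weakly decreasing order. Then there exist p×p complex Hermitian matrices Ã_1, ..., Ã_m such that Σ_{i=1}^m Ã_i = Σ_{i=1}^m A_i and, for each i, the eigenvalues of Ã_i are γ_i, γ_{i+m}, γ_{i+2m}, ..., γ_{i+m(p−1)}. -/

import Mathlib

/-- `M` is a Hermitian matrix whose eigenvalues, with multiplicity, are `{μ i : i}`. -/
def HasEigs {ι : Type} [Fintype ι] [DecidableEq ι] (M : Matrix ι ι ℂ) (μ : ι → ℝ) : Prop :=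
  ∃ U : Matrix ι ι ℂ, U * U.conjTranspose = 1 ∧ U.conjTranspose * U = 1 ∧
    M = U * Matrix.diagonal (fun i => (μ i : ℂ)) * U.conjTranspose

/-- `X` has singular values `s 1 ≥ s 2 ≥ ... ≥ s q ≥ 0` where `q = min(#rows, #cols)`:
`s` is weakly decreasing and nonnegative on `1..q`, and the eigenvalues of `Xᴴ * X`
are `s 1 ^ 2, ..., s q ^ 2` together with `#cols - q` zeros. -/
def HasSVals {ι κ : Type} [Fintype ι] [Fintype κ] [DecidableEq κ]
    (X : Matrix ι κ ℂ) (q : ℕ) (s : ℕ → ℝ) : Prop :=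
  q = min (Fintype.card ι) (Fintype.card κ) ∧
  (∀ a b, 1 ≤ a → a ≤ b → b ≤ q → s b ≤ s a) ∧
  (∀ a, 1 ≤ a → a ≤ q → 0 ≤ s a) ∧
  ∃ e : κ ≃ Fin (Fintype.card κ),
    HasEigs (X.conjTranspose * X)
      (fun j => if (e j : ℕ) + 1 ≤ q then s ((e j : ℕ) + 1) ^ 2 else 0)

open Polynomial in
theorem exists_basicOpen_subset_or_compl {Z : Set (PrimeSpectrum ℂ[X])}
    (hZ : Topology.IsConstructible Z) :
    (∃ q : ℂ[X], q ≠ 0 ∧ (PrimeSpectrum.basicOpen q : Set (PrimeSpectrum ℂ[X])) ⊆ Z) ∨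
    (∃ q : ℂ[X], q ≠ 0 ∧ (PrimeSpectrum.basicOpen q : Set (PrimeSpectrum ℂ[X])) ⊆ Zᶜ) := by
  induction hZ using Topology.IsConstructible.empty_union_induction with
  | open_retrocompact U hU _ =>
    rcases U.eq_empty_or_nonempty with rfl | ⟨x, hx⟩
    · exact Or.inr ⟨1, one_ne_zero, by simp⟩
    · obtain ⟨_, ⟨q, rfl⟩, hxq, hqU⟩ :=
        PrimeSpectrum.isTopologicalBasis_basic_opens.exists_subset_of_mem_open hx hU
      refine Or.inl ⟨q, ?_, hqU⟩
      rintro rfl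
      simp at hxq
  | union s hs t ht hs' ht' =>
    rcases hs' with ⟨q, hq, h⟩ | ⟨q, hq, h⟩
    · exact Or.inl ⟨q, hq, h.trans Set.subset_union_left⟩
    rcases ht' with ⟨q', hq', h'⟩ | ⟨q', hq', h'⟩
    · exact Or.inl ⟨q', hq', h'.trans Set.subset_union_right⟩
    refine Or.inr ⟨q * q', mul_ne_zero hq hq', ?_⟩
    rw [PrimeSpectrum.basicOpen_mul, Set.compl_union]
    exact Set.inter_subset_inter h h'
  | compl s hs hs' => rwa [compl_compl, or_comm]

open Polynomial MvPolynomial in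
/-- A polynomial system depending polynomially on a parameter `s` (the variable `none`)
that is solvable for infinitely many `s` is solvable for all but finitely many `s`. -/
theorem finite_setOf_not_solvable {σ ε : Type*} [Finite σ] [Finite ε]
    (P : ε → MvPolynomial (Option σ) ℂ)
    (hinf : {s : ℂ | ∃ z : σ → ℂ, ∀ e, MvPolynomial.eval (fun o => o.elim s z) (P e) = 0}.Infinite) :
    {s : ℂ | ¬ ∃ z : σ → ℂ, ∀ e, MvPolynomial.eval (fun o => o.elim s z) (P e) = 0}.Finite := by
  let I : Ideal (MvPolynomial (Option σ) ℂ) := Ideal.span (Set.range P)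
  let mk : MvPolynomial (Option σ) ℂ →ₐ[ℂ] MvPolynomial (Option σ) ℂ ⧸ I := Ideal.Quotient.mkₐ ℂ I
  let j : ℂ[X] →ₐ[ℂ] MvPolynomial (Option σ) ℂ := Polynomial.aeval (MvPolynomial.X none)
  let f : ℂ[X] →ₐ[ℂ] MvPolynomial (Option σ) ℂ ⧸ I := mk.comp j
  have hft : f.toRingHom.FinitePresentation := by
    apply RingHom.FinitePresentation.of_finiteType.mp
    have h1 : (algebraMap ℂ (MvPolynomial (Option σ) ℂ ⧸ I)).FiniteType :=
      RingHom.finiteType_algebraMap.mpr inferInstance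
    rw [← f.comp_algebraMap] at h1
    exact RingHom.FiniteType.of_comp_finiteType h1
  let pt : ℂ → PrimeSpectrum ℂ[X] := fun s =>
    ⟨RingHom.ker (Polynomial.evalRingHom s), RingHom.ker_isPrime _⟩
  have hpt : ∀ s q, pt s ∈ PrimeSpectrum.basicOpen q ↔ ¬ q.IsRoot s := by
    intro s q
    rfl
  have hj : ∀ (s : ℂ) (z : σ → ℂ) (q : ℂ[X]),
      MvPolynomial.eval (fun o => o.elim s z) (j q) = q.eval s := by
    intro s z q
    have : (MvPolynomial.aeval (R := ℂ) (fun o : Option σ => o.elim s z)).comp j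
        = Polynomial.aeval s := by
      ext; simp [j]
    have := DFunLike.congr_fun this q
    simpa [MvPolynomial.aeval_eq_eval] using this
  rcases exists_basicOpen_subset_or_compl (PrimeSpectrum.isConstructible_range_comap hft)
    with ⟨q, hq, h⟩ | ⟨q, hq, h⟩
  · refine (Polynomial.finite_setOfPred_isRoot hq).subset ?_
    intro s hs
    by_contra hroot
    obtain ⟨y, hy⟩ := h ((hpt s q).2 hroot)
    apply hs
    let J : Ideal (MvPolynomial (Option σ) ℂ) := y.asIdeal.comap mk
    have hJ : J ≠ ⊤ := (Ideal.IsPrime.comap mk (hK := y.2)).ne_top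
    have hIJ : I ≤ J := by
      intro a ha
      have : mk a = 0 := Ideal.Quotient.eq_zero_iff_mem.2 ha
      simp [J, Ideal.mem_comap, this]
    have hsJ : MvPolynomial.X none - MvPolynomial.C s ∈ J := by
      have h1 : (Polynomial.X - Polynomial.C s) ∈ (pt s).asIdeal := by
        simp [pt, RingHom.mem_ker]
      rw [← hy] at h1
      have h2 : f (Polynomial.X - Polynomial.C s) ∈ y.asIdeal := h1
      have h3 : f (Polynomial.X - Polynomial.C s) =
          mk (MvPolynomial.X none - MvPolynomial.C s) := by
        simp only [f, j, AlgHom.comp_apply, map_sub, Polynomial.aeval_X, Polynomial.aeval_C]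
        rfl
      rw [h3] at h2
      exact h2
    have hne : (MvPolynomial.zeroLocus ℂ J).Nonempty := by
      rw [Set.nonempty_iff_ne_empty]
      intro h0
      have h1 := MvPolynomial.vanishingIdeal_zeroLocus_eq_radical (K := ℂ) J
      rw [h0, MvPolynomial.vanishingIdeal_empty] at h1
      exact hJ (Ideal.radical_eq_top.1 h1.symm)
    obtain ⟨x, hx⟩ := hne
    rw [MvPolynomial.mem_zeroLocus_iff] at hx
    have hxs : x none = s := by
      have := hx _ hsJ
      simpa [sub_eq_zero] using this
    refine ⟨fun a => x (some a), fun e => ?_⟩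
    have h1 := hx _ (hIJ (Ideal.subset_span ⟨e, rfl⟩))
    rw [MvPolynomial.aeval_eq_eval] at h1
    have hfun : (fun o : Option σ => o.elim s (fun a => x (some a))) = x := by
      funext o
      cases o <;> simp [hxs]
    rwa [hfun]
  · refine absurd ((Polynomial.finite_setOfPred_isRoot hq).subset ?_) hinf
    rintro s ⟨z, hz⟩
    by_contra hroot
    refine h ((hpt s q).2 hroot) ?_
    let ev : MvPolynomial (Option σ) ℂ →+* ℂ := MvPolynomial.eval (fun o => o.elim s z)
    have hI : ∀ a ∈ I, ev a = 0 := by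
      intro a ha
      have : I ≤ RingHom.ker ev := Ideal.span_le.2 (by rintro _ ⟨e, rfl⟩; exact hz e)
      exact this ha
    let ev' : MvPolynomial (Option σ) ℂ ⧸ I →+* ℂ := Ideal.Quotient.lift I ev hI
    refine ⟨⟨RingHom.ker ev', RingHom.ker_isPrime _⟩, ?_⟩
    ext q'
    change ev' (mk (j q')) = 0 ↔ q'.eval s = 0
    rw [← hj s z q']
    rfl

/-- `f z s` is a polynomial function of the unknowns `z` and the parameter `s`. -/
def IsPolynomialFun {σ : Type*} (f : (σ → ℂ) → ℂ → ℂ) : Prop :=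
  ∃ P : MvPolynomial (Option σ) ℂ, ∀ z s, f z s = MvPolynomial.eval (fun o => o.elim s z) P

namespace IsPolynomialFun

variable {σ : Type*} {f g : (σ → ℂ) → ℂ → ℂ}

theorem const (c : ℂ) : IsPolynomialFun (fun (_ : σ → ℂ) _ => c) :=
  ⟨MvPolynomial.C c, by simp⟩

theorem param : IsPolynomialFun (fun (_ : σ → ℂ) s => s) :=
  ⟨MvPolynomial.X none, by simp⟩

theorem coord (i : σ) : IsPolynomialFun (fun (z : σ → ℂ) _ => z i) :=
  ⟨MvPolynomial.X (some i), by simp⟩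

theorem add (hf : IsPolynomialFun f) (hg : IsPolynomialFun g) :
    IsPolynomialFun (fun z s => f z s + g z s) := by
  obtain ⟨P, hP⟩ := hf
  obtain ⟨R, hR⟩ := hg
  exact ⟨P + R, by simp [hP, hR]⟩

theorem sub (hf : IsPolynomialFun f) (hg : IsPolynomialFun g) :
    IsPolynomialFun (fun z s => f z s - g z s) := by
  obtain ⟨P, hP⟩ := hf
  obtain ⟨R, hR⟩ := hg
  exact ⟨P - R, by simp [hP, hR]⟩

theorem mul (hf : IsPolynomialFun f) (hg : IsPolynomialFun g) :
    IsPolynomialFun (fun z s => f z s * g z s) := by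
  obtain ⟨P, hP⟩ := hf
  obtain ⟨R, hR⟩ := hg
  exact ⟨P * R, by simp [hP, hR]⟩

theorem sum {α : Type*} (t : Finset α) {F : α → (σ → ℂ) → ℂ → ℂ}
    (hF : ∀ a, IsPolynomialFun (F a)) :
    IsPolynomialFun (fun z s => ∑ a ∈ t, F a z s) := by
  choose P hP using hF
  exact ⟨∑ a ∈ t, P a, by simp [hP]⟩

theorem prod {α : Type*} (t : Finset α) {F : α → (σ → ℂ) → ℂ → ℂ}
    (hF : ∀ a, IsPolynomialFun (F a)) :
    IsPolynomialFun (fun z s => ∏ a ∈ t, F a z s) := by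
  choose P hP using hF
  exact ⟨∏ a ∈ t, P a, by simp [hP]⟩

theorem contDiff [Fintype σ] (hf : IsPolynomialFun f) :
    ContDiff ℂ 1 (fun x : (σ → ℂ) × ℂ => f x.1 x.2) := by
  obtain ⟨P, hP⟩ := hf
  simp only [hP]
  clear hP
  induction P using MvPolynomial.induction_on with
  | C a => simpa using contDiff_const
  | add p q hp hq => simpa using hp.add hq
  | mul_X p n hp =>
    simp only [map_mul, MvPolynomial.eval_X]
    refine hp.mul ?_
    cases n with
    | none => simpa using contDiff_snd
    | some i => exact (contDiff_apply ℂ ℂ i).comp contDiff_fst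

end IsPolynomialFun

/-- A square-or-underdetermined polynomial system that vanishes at the origin and has injective
linearisation there is solvable for all but finitely many values of the parameter. -/
theorem finite_setOf_not_solvable_of_linearization {σ ε : Type*} [Fintype σ] [Fintype ε]
    (F : ε → (σ → ℂ) → ℂ → ℂ) (hF : ∀ e, IsPolynomialFun (F e))
    (hcard : Fintype.card ε ≤ Fintype.card σ)
    (lin quad : ε → (σ → ℂ) → ℂ)
    (hexp : ∀ e z (t : ℂ), F e (t • z) 0 = t * lin e z + t ^ 2 * quad e z)
    (hinj : ∀ z, (∀ e, lin e z = 0) → z = 0) :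
    {s : ℂ | ¬ ∃ z : σ → ℂ, ∀ e, F e z s = 0}.Finite := by
  choose P hP using hF
  suffices h : {s : ℂ | ∃ z : σ → ℂ, ∀ e, F e z s = 0}.Infinite by
    simp only [hP] at h ⊢
    exact finite_setOf_not_solvable P h
  let Ψ : (σ → ℂ) × ℂ → (ε → ℂ) × ℂ := fun x => (fun e => F e x.1 x.2, x.2)
  have hΨ : ContDiff ℂ 1 Ψ :=
    (contDiff_pi.2 fun e => IsPolynomialFun.contDiff ⟨P e, hP e⟩).prodMk contDiff_snd
  have hst : HasStrictFDerivAt Ψ (fderiv ℂ Ψ 0) 0 :=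
    hΨ.contDiffAt.hasStrictFDerivAt one_ne_zero
  have hlin : ∀ z e, (fderiv ℂ Ψ 0 (z, 0)).1 e = lin e z := by
    intro z e
    have h1 : HasDerivAt (fun t : ℂ => t • ((z, 0) : (σ → ℂ) × ℂ)) (z, 0) 0 := by
      simpa using (hasDerivAt_id (0 : ℂ)).smul_const ((z, 0) : (σ → ℂ) × ℂ)
    have h2 : HasFDerivAt Ψ (fderiv ℂ Ψ 0) ((0 : ℂ) • ((z, 0) : (σ → ℂ) × ℂ)) := by
      rw [zero_smul]; exact hst.hasFDerivAt
    have h3 := h2.comp_hasDerivAt (0 : ℂ) h1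
    have h4 : HasDerivAt (fun t : ℂ => F e (t • z) 0) ((fderiv ℂ Ψ 0 (z, 0)).1 e) 0 := by
      have := (hasDerivAt_pi.1 (h3.fst)) e
      simpa [Ψ, Function.comp_def] using this
    have h5 : HasDerivAt (fun t : ℂ => F e (t • z) 0) (lin e z) 0 := by
      simp only [hexp]
      have := ((hasDerivAt_id (0 : ℂ)).mul_const (lin e z)).add
        (((hasDerivAt_id (0 : ℂ)).pow 2).mul_const (quad e z))
      have hval : 1 * lin e z + (2 : ℕ) * (id 0 : ℂ) ^ (2 - 1) * 1 * quad e z = lin e z := by simp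
      rw [hval] at this
      exact this
    exact h4.unique h5
  have hsnd : ∀ x, (fderiv ℂ Ψ 0 x).2 = x.2 := by
    intro x
    have h1 : HasFDerivAt (fun x => (Ψ x).2) _ (0 : (σ → ℂ) × ℂ) := hst.hasFDerivAt.snd
    have h2 : HasFDerivAt (fun x => (Ψ x).2) (ContinuousLinearMap.snd ℂ (σ → ℂ) ℂ) 0 :=
      hasFDerivAt_snd
    exact DFunLike.congr_fun (h1.unique h2) x
  have hsurj : (fderiv ℂ Ψ 0).range = ⊤ := by
    have hker : Function.Injective (fderiv ℂ Ψ 0).toLinearMap := by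
      rw [← LinearMap.ker_eq_bot, LinearMap.ker_eq_bot']
      rintro ⟨z, s⟩ h0
      have h0' : fderiv ℂ Ψ 0 (z, s) = 0 := h0
      have hs : s = 0 := by simpa [h0'] using (hsnd (z, s)).symm
      subst hs
      have : z = 0 := hinj z fun e => by rw [← hlin z e, h0']; rfl
      rw [this]; rfl
    have h1 := LinearMap.finrank_range_of_inj hker
    apply Submodule.eq_top_of_finrank_eq
    refine le_antisymm (Submodule.finrank_le _) ?_
    refine le_trans ?_ h1.ge
    simpa using hcard
  have hmap := hst.map_nhds_eq_of_surj hsurj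
  have h00 : Ψ 0 = 0 := by
    ext e
    · have := hexp e 0 0
      simp only [smul_zero, zero_mul, ne_eq, OfNat.ofNat_ne_zero, not_false_eq_true, zero_pow,
        add_zero] at this
      exact this
    · rfl
  rw [h00] at hmap
  have hev : ∀ᶠ y in nhds (0 : (ε → ℂ) × ℂ), ∃ x, Ψ x = y := by
    rw [← hmap, Filter.eventually_map]
    exact Filter.Eventually.of_forall fun x => ⟨x, rfl⟩
  have hev2 : ∀ᶠ s in nhds (0 : ℂ), ∃ x, Ψ x = (0, s) := by
    have : Filter.Tendsto (fun s : ℂ => ((0 : ε → ℂ), s)) (nhds 0) (nhds 0) :=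
      (Continuous.prodMk_right _).tendsto' _ _ rfl
    exact this.eventually hev
  refine (infinite_of_mem_nhds (0 : ℂ) hev2).mono ?_
  rintro s ⟨⟨z, s'⟩, hx⟩
  have h1 : s' = s := congrArg Prod.snd hx
  subst h1
  exact ⟨z, fun e => congrFun (congrArg Prod.fst hx) e⟩

open Matrix InnerProductSpace in
theorem exists_orthonormal_columns_fin {X ι : Type*} [Fintype X] {n : ℕ} (a : X → ℝ) (π : X → ι)
    (V : Matrix X (Fin n) ℂ) (P : Matrix (Fin n) X ℂ) (hPV : P * V = 1)
    (b : Fin n → ℝ) (ρ : Fin n → ι) (hb : Monotone b)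
    (hV : ∀ q i, V q i ≠ 0 → π q = ρ i ∧ a q ≤ b i) :
    ∃ (S : Matrix X (Fin n) ℂ) (Z Z' : Matrix (Fin n) (Fin n) ℂ), Sᴴ * S = 1 ∧ S = V * Z ∧
      V = S * Z' ∧ ∀ q i, S q i ≠ 0 → π q = ρ i ∧ a q ≤ b i := by
  let f : Fin n → EuclideanSpace ℂ X := fun i => WithLp.toLp 2 (fun q => V q i)
  have hli : LinearIndependent ℂ f := by
    rw [Fintype.linearIndependent_iff]
    intro g hg i
    have h1 : V *ᵥ g = 0 := by
      funext q
      have := congrArg (fun v : EuclideanSpace ℂ X => v q) hg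
      simpa [f, Matrix.mulVec, dotProduct, mul_comm] using this
    have h2 : g = 0 := by
      rw [← Matrix.one_mulVec g, ← hPV, ← Matrix.mulVec_mulVec, h1, Matrix.mulVec_zero]
    rw [h2]; rfl
  let g := gramSchmidt ℂ f
  have hg : ∀ i q, g i q ≠ 0 → π q = ρ i ∧ a q ≤ b i := by
    intro i
    induction i using WellFoundedLT.induction with
    | ind i ih =>
    intro q hq
    by_contra hcon
    apply hq
    have hfq : f i q = 0 := by
      by_contra h
      exact hcon (hV q i h)
    have hdef := congrArg (fun v : EuclideanSpace ℂ X => v q) (gramSchmidt_def'' ℂ f i)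
    simp only [PiLp.add_apply, hfq, WithLp.ofLp_sum, Finset.sum_apply, PiLp.smul_apply] at hdef
    have hsum : ∑ j ∈ Finset.Iio i, (inner ℂ (gramSchmidt ℂ f j) (f i) /
        ((‖gramSchmidt ℂ f j‖ : ℝ) : ℂ) ^ 2) • (gramSchmidt ℂ f j) q = 0 := by
      refine Finset.sum_eq_zero fun j hj => ?_
      rw [Finset.mem_Iio] at hj
      by_cases hjq : g j q = 0
      · rw [show gramSchmidt ℂ f j q = 0 from hjq, smul_zero]
      obtain ⟨hπ, ha⟩ := ih j hj q hjq
      have hne : π q ≠ ρ i := fun h => hcon ⟨h, ha.trans (hb hj.le)⟩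
      have : inner ℂ (gramSchmidt ℂ f j) (f i) = 0 := by
        rw [PiLp.inner_apply]
        refine Finset.sum_eq_zero fun q' _ => ?_
        by_cases h1 : g j q' = 0
        · rw [show gramSchmidt ℂ f j q' = 0 from h1, inner_zero_left]
        · have h2 : f i q' = 0 := by
            by_contra h
            exact hne (hπ.trans ((ih j hj q' h1).1.symm.trans (hV q' i h).1))
          rw [h2, inner_zero_right]
      rw [this, zero_div, zero_smul]
    have h0 := hdef.trans (congrArg ((gramSchmidt ℂ f i) q + ·) hsum)
    simpa using h0.symm
  let s := gramSchmidtNormed ℂ f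
  have hs : Orthonormal ℂ s := gramSchmidtNormed_orthonormal hli
  have hspan : Submodule.span ℂ (Set.range s) = Submodule.span ℂ (Set.range f) := by
    rw [span_gramSchmidtNormed_range, span_gramSchmidt]
  have h1 : ∀ i, ∃ c : Fin n → ℂ, ∑ j, c j • f j = s i := fun i =>
    (Submodule.mem_span_range_iff_exists_fun ℂ).1 (hspan ▸ Submodule.subset_span ⟨i, rfl⟩)
  have h2 : ∀ i, ∃ c : Fin n → ℂ, ∑ j, c j • s j = f i := fun i =>
    (Submodule.mem_span_range_iff_exists_fun ℂ).1 (hspan ▸ Submodule.subset_span ⟨i, rfl⟩)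
  choose z hz using h1
  choose z' hz' using h2
  refine ⟨Matrix.of fun q i => s i q, Matrix.of fun j i => z i j, Matrix.of fun j i => z' i j,
    ?_, ?_, ?_, ?_⟩
  · ext i j
    have := orthonormal_iff_ite.1 hs i j
    rw [PiLp.inner_apply] at this
    simpa [Matrix.mul_apply, Matrix.one_apply, mul_comm] using this
  · ext q i
    have := congrArg (fun v : EuclideanSpace ℂ X => v q) (hz i)
    simpa [Matrix.mul_apply, f, mul_comm] using this.symm
  · ext q i
    have := congrArg (fun v : EuclideanSpace ℂ X => v q) (hz' i)
    simpa [Matrix.mul_apply, f, mul_comm] using this.symm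
  · intro q i hq
    apply hg i q
    intro h0
    apply hq
    change (gramSchmidtNormed ℂ f i) q = 0
    rw [gramSchmidtNormed, PiLp.smul_apply, show (gramSchmidt ℂ f i) q = 0 from h0, smul_zero]

open Matrix in
/-- Gram–Schmidt orthogonalisation preserving blocks and sublevel supports. -/
theorem exists_orthonormal_columns {X ι N : Type*} [Fintype X] [Fintype N] [DecidableEq N]
    (a : X → ℝ) (π : X → ι)
    (V : Matrix X N ℂ) (P : Matrix N X ℂ) (hPV : P * V = 1)
    (b : N → ℝ) (ρ : N → ι)
    (hV : ∀ q i, V q i ≠ 0 → π q = ρ i ∧ a q ≤ b i) :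
    ∃ (S : Matrix X N ℂ) (Z Z' : Matrix N N ℂ), Sᴴ * S = 1 ∧ S = V * Z ∧
      V = S * Z' ∧ ∀ q i, S q i ≠ 0 → π q = ρ i ∧ a q ≤ b i := by
  let e₀ : Fin (Fintype.card N) ≃ N := (Fintype.equivFin N).symm
  let e : Fin (Fintype.card N) ≃ N := (Tuple.sort (b ∘ e₀)).trans e₀
  have he : Monotone (b ∘ e) := Tuple.monotone_sort (b ∘ e₀)
  obtain ⟨S, Z, Z', h1, h2, h3, h4⟩ := exists_orthonormal_columns_fin a π
    (V.submatrix id e) (P.submatrix e id)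
    (by rw [← Matrix.submatrix_mul P V e id e Function.bijective_id, hPV]; simp) (b ∘ e) (ρ ∘ e) he
    (fun q i h => hV q (e i) h)
  refine ⟨S.submatrix id e.symm, Z.submatrix e.symm e.symm, Z'.submatrix e.symm e.symm,
    ?_, ?_, ?_, ?_⟩
  · rw [conjTranspose_submatrix, ← Matrix.submatrix_mul _ _ e.symm id e.symm Function.bijective_id, h1]
    simp
  · rw [h2, Matrix.submatrix_mul (V.submatrix id e) Z id e.symm e.symm e.symm.bijective]
    simp
  · rw [Matrix.submatrix_mul_equiv S Z' id e.symm e.symm, ← h3]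
    simp
  · intro q i h
    simpa using h4 q (e.symm i) h

open Matrix in
theorem re_trace_conjTranspose_diagonal_le {X N : Type*} [Fintype X] [DecidableEq X] [Fintype N]
    [DecidableEq N] (a : X → ℝ) (b : N → ℝ) (S : Matrix X N ℂ) (hS : Sᴴ * S = 1)
    (hsupp : ∀ q i, S q i ≠ 0 → a q ≤ b i) :
    (Sᴴ * diagonal (fun q => (a q : ℂ)) * S).trace.re ≤ ∑ i, b i := by
  rw [Matrix.trace, Complex.re_sum]
  refine Finset.sum_le_sum fun i _ => ?_
  have h1 : ∑ q, ‖S q i‖ ^ 2 = 1 := by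
    have := congrFun (congrFun hS i) i
    rw [Matrix.mul_apply, Matrix.one_apply_eq] at this
    have h2 := congrArg Complex.re this
    rw [Complex.re_sum] at h2
    simpa [Complex.normSq_eq_norm_sq, Complex.conj_mul', ← Complex.ofReal_pow] using h2
  calc ((Sᴴ * diagonal (fun q => (a q : ℂ)) * S).diag i).re
      = ∑ q, a q * ‖S q i‖ ^ 2 := by
        rw [Matrix.diag_apply, Matrix.mul_apply, Complex.re_sum]
        refine Finset.sum_congr rfl fun q _ => ?_
        rw [Matrix.mul_diagonal, Matrix.conjTranspose_apply, mul_right_comm, mul_comm,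
          ← starRingEnd_apply, Complex.conj_mul', ← Complex.ofReal_pow, ← Complex.ofReal_mul,
          Complex.ofReal_re]
    _ ≤ ∑ q, b i * ‖S q i‖ ^ 2 := by
        refine Finset.sum_le_sum fun q _ => ?_
        by_cases hq : S q i = 0
        · simp [hq]
        · exact mul_le_mul_of_nonneg_right (hsupp q i hq) (by positivity)
    _ = b i := by rw [← Finset.mul_sum, h1, mul_one]

open Matrix in
theorem norm_apply_le_one_of_orthonormal {X N : Type*} [Fintype X] [DecidableEq N]
    (S : Matrix X N ℂ) (hS : Sᴴ * S = 1) (q : X) (i : N) : ‖S q i‖ ≤ 1 := by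
  have h1 : ∑ q, ‖S q i‖ ^ 2 = 1 := by
    have := congrFun (congrFun hS i) i
    rw [Matrix.mul_apply, Matrix.one_apply_eq] at this
    have h2 := congrArg Complex.re this
    rw [Complex.re_sum] at h2
    simpa [Complex.normSq_eq_norm_sq, Complex.conj_mul', ← Complex.ofReal_pow] using h2
  have h2 : ‖S q i‖ ^ 2 ≤ 1 := by
    rw [← h1]
    exact Finset.single_le_sum (f := fun q => ‖S q i‖ ^ 2) (fun _ _ => by positivity)
      (Finset.mem_univ q)
  exact (sq_le_one_iff₀ (norm_nonneg _)).1 h2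

open Matrix in
/-- Two triangular frames of the same subspace compare the partial traces of `c` and `γ`. -/
theorem sum_sub_sum_le_of_frames {X Y ι N L : Type*} [Fintype X] [DecidableEq X] [Fintype Y]
    [DecidableEq Y] [DecidableEq ι] [Fintype N] [DecidableEq N] [Fintype L] [DecidableEq L]
    (hcard : Fintype.card N = Fintype.card L)
    (γ : X → ℝ) (c : Y → ℝ) (π : Y → ι) (γN : N → ℝ) (cL : L → ℝ) (ρ : L → ι)
    (Q : Matrix Y X ℂ) (hQ : Qᴴ * Q = 1)
    (V : Matrix X N ℂ) (PV : Matrix N X ℂ) (hPV : PV * V = 1)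
    (hV : ∀ q x, V q x ≠ 0 → γ q ≤ γN x)
    (T : Matrix Y L ℂ) (PT : Matrix L Y ℂ) (hPT : PT * T = 1)
    (hT : ∀ y' y, T y' y ≠ 0 → π y' = ρ y ∧ cL y ≤ c y')
    (Z : Matrix L N ℂ) (hQV : Q * V = T * Z) :
    ∑ y, cL y - ∑ x, γN x ≤ Fintype.card L * ∑ y, ∑ y', if π y = π y' then
      ‖(Q * diagonal (fun x => (γ x : ℂ)) * Qᴴ - diagonal (fun y => (c y : ℂ))) y y'‖ else 0 := by
  obtain ⟨S, Z₁, -, hS, hSV, -, hSsupp⟩ := exists_orthonormal_columns γ (fun _ => ()) V PV hPV γN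
    (fun _ => ()) (fun q x h => ⟨rfl, hV q x h⟩)
  obtain ⟨τ, -, Z₂, hτ, -, hTτ, hτsupp⟩ := exists_orthonormal_columns (fun y => -c y) π T PT hPT
    (fun y => -cL y) ρ (fun q x h => ⟨(hT q x h).1, neg_le_neg (hT q x h).2⟩)
  set M := Q * diagonal (fun x => (γ x : ℂ)) * Qᴴ with hM
  set D := M - diagonal (fun y => (c y : ℂ)) with hD
  obtain ⟨R, hR⟩ : ∃ R, R = Z₂ * Z * Z₁ := ⟨_, rfl⟩
  have hQS : Q * S = τ * R := by
    rw [hSV, ← Matrix.mul_assoc, hQV, hTτ, hR]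
    simp only [Matrix.mul_assoc]
  have hRR : Rᴴ * R = 1 := by
    calc Rᴴ * R = Rᴴ * (τᴴ * τ) * R := by rw [hτ, Matrix.mul_one]
      _ = (τ * R)ᴴ * (τ * R) := by rw [conjTranspose_mul]; simp only [Matrix.mul_assoc]
      _ = Sᴴ * (Qᴴ * Q) * S := by rw [← hQS, conjTranspose_mul]; simp only [Matrix.mul_assoc]
      _ = 1 := by rw [hQ, Matrix.mul_one, hS]
  have hRR' : R * Rᴴ = 1 := (Matrix.mul_eq_one_comm_of_card_eq _ _ _ hcard).1 hRR
  have htr : (τᴴ * M * τ).trace = (Sᴴ * diagonal (fun x => (γ x : ℂ)) * S).trace := by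
    calc (τᴴ * M * τ).trace = (τᴴ * M * τ * (R * Rᴴ)).trace := by rw [hRR', Matrix.mul_one]
      _ = (Rᴴ * (τᴴ * M * τ * R)).trace := by rw [← Matrix.mul_assoc, Matrix.trace_mul_comm]
      _ = ((τ * R)ᴴ * M * (τ * R)).trace := by
        rw [conjTranspose_mul]; simp only [Matrix.mul_assoc]
      _ = (Sᴴ * (Qᴴ * Q) * diagonal (fun x => (γ x : ℂ)) * (Qᴴ * Q) * S).trace := by
        rw [← hQS, conjTranspose_mul, hM]; simp only [Matrix.mul_assoc]
      _ = _ := by rw [hQ, Matrix.mul_one, Matrix.mul_one]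
  have hle := re_trace_conjTranspose_diagonal_le γ γN S hS (fun q i h => (hSsupp q i h).2)
  have hge := re_trace_conjTranspose_diagonal_le (fun y => -c y) (fun y => -cL y) τ hτ
    (fun q i h => (hτsupp q i h).2)
  have hdiag : (diagonal (fun q => ((-c q : ℝ) : ℂ))) = -diagonal (fun y => (c y : ℂ)) := by
    rw [Matrix.diagonal_neg]; simp
  rw [hdiag, Matrix.mul_neg, Matrix.neg_mul, Matrix.trace_neg, Complex.neg_re,
    Finset.sum_neg_distrib] at hge
  have hsplit : (τᴴ * M * τ).trace = (τᴴ * diagonal (fun y => (c y : ℂ)) * τ).trace +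
      (τᴴ * D * τ).trace := by
    rw [← Matrix.trace_add, ← Matrix.add_mul, ← Matrix.mul_add, hD]
    simp
  have hDb : ‖(τᴴ * D * τ).trace‖ ≤ Fintype.card L * ∑ y, ∑ y', if π y = π y' then
      ‖D y y'‖ else 0 := by
    rw [Matrix.trace]
    refine (norm_sum_le _ _).trans ?_
    rw [← nsmul_eq_mul, ← Finset.card_univ]
    refine Finset.sum_le_card_nsmul _ _ _ fun l _ => ?_
    rw [Matrix.diag_apply, Matrix.mul_apply]
    simp only [Matrix.mul_apply, Finset.sum_mul]
    rw [Finset.sum_comm]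
    refine (norm_sum_le _ _).trans (Finset.sum_le_sum fun y _ => ?_)
    refine (norm_sum_le _ _).trans (Finset.sum_le_sum fun y' _ => ?_)
    rw [conjTranspose_apply, norm_mul, norm_mul, norm_star]
    have h1 := norm_apply_le_one_of_orthonormal τ hτ y l
    have h2 := norm_apply_le_one_of_orthonormal τ hτ y' l
    split_ifs with h
    · calc ‖τ y l‖ * ‖D y y'‖ * ‖τ y' l‖ ≤ 1 * ‖D y y'‖ * 1 := by gcongr
        _ = _ := by ring
    · have : τ y l = 0 ∨ τ y' l = 0 := by
        by_contra hcon
        push Not at hcon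
        exact h ((hτsupp y l hcon.1).1.trans (hτsupp y' l hcon.2).1.symm)
      rcases this with h0 | h0 <;> simp [h0]
  have hre := (neg_le_neg hDb).trans (neg_le_of_abs_le (Complex.abs_re_le_norm _))
  have h3 := congrArg Complex.re (hsplit.symm.trans htr)
  rw [Complex.add_re] at h3
  linarith

open Matrix in
theorem trace_conjTranspose_diagonal {X Y : Type*} [Fintype X] [DecidableEq X] [Fintype Y]
    (g : X → ℝ) (U : Matrix X Y ℂ) :
    (Uᴴ * diagonal (fun q => (g q : ℂ)) * U).trace = ((∑ x, ∑ q, g q * ‖U q x‖ ^ 2 : ℝ) : ℂ) := by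
  rw [Matrix.trace]
  push_cast
  refine Finset.sum_congr rfl fun x _ => ?_
  rw [Matrix.diag_apply, Matrix.mul_apply]
  refine Finset.sum_congr rfl fun q _ => ?_
  rw [Matrix.mul_diagonal, Matrix.conjTranspose_apply, mul_right_comm, mul_comm,
    ← starRingEnd_apply, Complex.conj_mul']

open Matrix in
theorem trace_conjTranspose_mul_eq_of_blocks {Y ι : Type*} [Fintype Y] [DecidableEq Y]
    (π : Y → ι) (M : Matrix Y Y ℂ) (d : Y → ℝ)
    (hM : ∀ y y', π y = π y' → M y y' = diagonal (fun y => (d y : ℂ)) y y')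
    (Φ : Matrix Y Y ℂ) (hΦ : ∀ y y', Φ y y' ≠ 0 → π y = π y') :
    (Φᴴ * M * Φ).trace = (Φᴴ * diagonal (fun y => (d y : ℂ)) * Φ).trace := by
  simp only [Matrix.trace, Matrix.diag_apply, Matrix.mul_apply, Finset.sum_mul]
  refine Finset.sum_congr rfl fun y _ => Finset.sum_congr rfl fun a _ =>
    Finset.sum_congr rfl fun b _ => ?_
  by_cases h1 : Φ a y = 0
  · simp [h1]
  by_cases h2 : Φ b y = 0
  · simp [h2]
  rw [hM b a ((hΦ b y h2).trans (hΦ a y h1).symm)]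

open Matrix in
/-- Injectivity of the linearised intertwining equation `Q * U = Φ * Q`. -/
theorem eq_zero_of_intertwine {X Y ι : Type*} [Fintype X] [DecidableEq X]
    [Fintype Y] [DecidableEq Y] (π : Y → ι) (γ : X → ℝ) (c h : Y → ℝ)
    (Q : Matrix Y X ℂ) (hQ : Qᴴ * Q = 1) (hQ' : Q * Qᴴ = 1)
    (hM : ∀ y y', π y = π y' → (Q * diagonal (fun x => (γ x : ℂ)) * Qᴴ) y y' =
      diagonal (fun y => ((c y - h y : ℝ) : ℂ)) y y')
    (U : Matrix X X ℂ) (hU : ∀ q x, U q x ≠ 0 → γ q < γ x)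
    (Φ : Matrix Y Y ℂ) (hΦ : ∀ y' y, Φ y' y ≠ 0 → π y' = π y ∧ c y ≤ c y' ∧ h y' < h y)
    (heq : Q * U = Φ * Q) : U = 0 ∧ Φ = 0 := by
  have hU' : U = Qᴴ * Φ * Q := by
    rw [Matrix.mul_assoc, ← heq, ← Matrix.mul_assoc, hQ, Matrix.one_mul]
  have h1 : (Uᴴ * diagonal (fun x => (γ x : ℂ)) * U).trace =
      (Φᴴ * diagonal (fun y => ((c y - h y : ℝ) : ℂ)) * Φ).trace := by
    rw [← trace_conjTranspose_mul_eq_of_blocks π _ _ hM Φ (fun a b hab => (hΦ a b hab).1), hU',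
      conjTranspose_mul, conjTranspose_mul, conjTranspose_conjTranspose]
    calc (Qᴴ * (Φᴴ * Q) * diagonal (fun x => (γ x : ℂ)) * (Qᴴ * Φ * Q)).trace
        = (Qᴴ * (Φᴴ * (Q * diagonal (fun x => (γ x : ℂ)) * Qᴴ) * Φ * Q)).trace := by
          simp only [Matrix.mul_assoc]
      _ = _ := by
          rw [Matrix.trace_mul_comm, Matrix.mul_assoc, hQ', Matrix.mul_one]
  have h2 : (Uᴴᴴ * diagonal (fun x => (γ x : ℂ)) * Uᴴ).trace =
      (Φᴴᴴ * diagonal (fun y => ((c y - h y : ℝ) : ℂ)) * Φᴴ).trace := by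
    rw [← trace_conjTranspose_mul_eq_of_blocks π _ _ hM Φᴴ
      (fun a b hab => (hΦ b a (by simpa using hab)).1.symm), hU',
      conjTranspose_mul, conjTranspose_mul]
    simp only [conjTranspose_mul, conjTranspose_conjTranspose]
    calc (Qᴴ * Φ * Q * diagonal (fun x => (γ x : ℂ)) * (Qᴴ * (Φᴴ * Q))).trace
        = (Qᴴ * (Φ * (Q * diagonal (fun x => (γ x : ℂ)) * Qᴴ) * Φᴴ * Q)).trace := by
          simp only [Matrix.mul_assoc]
      _ = _ := by
          rw [Matrix.trace_mul_comm, Matrix.mul_assoc, hQ', Matrix.mul_one]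
  rw [trace_conjTranspose_diagonal, trace_conjTranspose_diagonal, Complex.ofReal_inj] at h1 h2
  simp only [conjTranspose_apply, norm_star] at h2
  rw [Finset.sum_comm (f := fun x q => γ q * ‖U x q‖ ^ 2),
    Finset.sum_comm (f := fun x q => (c q - h q) * ‖Φ x q‖ ^ 2)] at h2
  have h3 : ∑ x, ∑ q, (γ x - γ q) * ‖U q x‖ ^ 2 +
      ∑ y, ∑ y', ((c y' - c y) + (h y - h y')) * ‖Φ y' y‖ ^ 2 = 0 := by
    have e1 : ∑ x, ∑ q, (γ x - γ q) * ‖U q x‖ ^ 2 =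
        ∑ x, ∑ q, γ x * ‖U q x‖ ^ 2 - ∑ x, ∑ q, γ q * ‖U q x‖ ^ 2 := by
      simp only [← Finset.sum_sub_distrib, sub_mul]
    have e2 : ∑ y, ∑ y', ((c y' - c y) + (h y - h y')) * ‖Φ y' y‖ ^ 2 =
        ∑ y, ∑ y', (c y' - h y') * ‖Φ y' y‖ ^ 2 - ∑ y, ∑ y', (c y - h y) * ‖Φ y' y‖ ^ 2 := by
      simp only [← Finset.sum_sub_distrib]
      refine Finset.sum_congr rfl fun _ _ => Finset.sum_congr rfl fun _ _ => ?_
      ring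
    rw [e1, e2, ← h1, ← h2]
    ring
  have nU : ∀ x q, 0 ≤ (γ x - γ q) * ‖U q x‖ ^ 2 := by
    intro x q
    by_cases h0 : U q x = 0
    · simp [h0]
    · have := hU q x h0
      have : 0 ≤ γ x - γ q := by linarith
      positivity
  have nΦ : ∀ y y', 0 ≤ ((c y' - c y) + (h y - h y')) * ‖Φ y' y‖ ^ 2 := by
    intro y y'
    by_cases h0 : Φ y' y = 0
    · simp [h0]
    · have := hΦ y' y h0
      have : 0 ≤ (c y' - c y) + (h y - h y') := by linarith
      positivity
  have sU : 0 ≤ ∑ x, ∑ q, (γ x - γ q) * ‖U q x‖ ^ 2 :=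
    Finset.sum_nonneg fun _ _ => Finset.sum_nonneg fun _ _ => nU _ _
  have sΦ : 0 ≤ ∑ y, ∑ y', ((c y' - c y) + (h y - h y')) * ‖Φ y' y‖ ^ 2 :=
    Finset.sum_nonneg fun _ _ => Finset.sum_nonneg fun _ _ => nΦ _ _
  have zU : ∑ x, ∑ q, (γ x - γ q) * ‖U q x‖ ^ 2 = 0 := by linarith
  have zΦ : ∑ y, ∑ y', ((c y' - c y) + (h y - h y')) * ‖Φ y' y‖ ^ 2 = 0 := by linarith
  constructor
  · ext q x
    by_contra h0
    have hlt := hU q x h0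
    have e := (Finset.sum_eq_zero_iff_of_nonneg
      fun x _ => Finset.sum_nonneg fun q _ => nU x q).1 zU x (Finset.mem_univ _)
    have e' := (Finset.sum_eq_zero_iff_of_nonneg fun q _ => nU x q).1 e q (Finset.mem_univ _)
    have : 0 < (γ x - γ q) * ‖U q x‖ ^ 2 :=
      mul_pos (by linarith) (pow_pos (norm_pos_iff.2 h0) 2)
    linarith
  · ext y' y
    by_contra h0
    have hlt := hΦ y' y h0
    have e := (Finset.sum_eq_zero_iff_of_nonneg
      fun x _ => Finset.sum_nonneg fun q _ => nΦ x q).1 zΦ y (Finset.mem_univ _)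
    have e' := (Finset.sum_eq_zero_iff_of_nonneg fun q _ => nΦ y q).1 e y' (Finset.mem_univ _)
    have : 0 < ((c y' - c y) + (h y - h y')) * ‖Φ y' y‖ ^ 2 :=
      mul_pos (by linarith) (pow_pos (norm_pos_iff.2 h0) 2)
    linarith

open Matrix in
/-- A block triangular unitary matrix with square diagonal blocks is block diagonal. -/
theorem apply_eq_zero_of_block_triangular {X Y : Type*} [Fintype X] [DecidableEq X]
    [Fintype Y] [DecidableEq Y] (N : Finset X) (L : Finset Y) (hcard : N.card = L.card)
    (Q : Matrix Y X ℂ) (hQ : Qᴴ * Q = 1) (hQ' : Q * Qᴴ = 1)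
    (h0 : ∀ y ∉ L, ∀ x ∈ N, Q y x = 0) : ∀ y ∈ L, ∀ x ∉ N, Q y x = 0 := by
  let B : Matrix L N ℂ := Q.submatrix (↑) (↑)
  have hB : Bᴴ * B = 1 := by
    ext x x'
    have := congrFun (congrFun hQ x) x'
    rw [Matrix.mul_apply, ← Finset.sum_subset (Finset.subset_univ L)
      (fun y _ hy => by simp [h0 y hy x' x'.2])] at this
    rw [← Finset.sum_coe_sort L] at this
    rw [Matrix.mul_apply]
    simpa [B, Matrix.one_apply] using this
  have hB' : B * Bᴴ = 1 := (Matrix.mul_eq_one_comm_of_card_eq _ _ _ (by simpa using hcard)).1 hB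
  intro y hy
  have e1 : ∑ x ∈ N, ‖Q y x‖ ^ 2 = 1 := by
    have := congrArg Complex.re (congrFun (congrFun hB' ⟨y, hy⟩) ⟨y, hy⟩)
    rw [Matrix.mul_apply, Complex.re_sum, Matrix.one_apply_eq] at this
    rw [← Finset.sum_coe_sort N]
    simpa [B, Complex.mul_conj', ← Complex.ofReal_pow] using this
  have e2 : ∑ x, ‖Q y x‖ ^ 2 = 1 := by
    have := congrArg Complex.re (congrFun (congrFun hQ' y) y)
    rw [Matrix.mul_apply, Complex.re_sum, Matrix.one_apply_eq] at this
    simpa [Complex.mul_conj', ← Complex.ofReal_pow] using this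
  rw [← Finset.sum_add_sum_compl N, e1] at e2
  have e3 : ∑ x ∈ Nᶜ, ‖Q y x‖ ^ 2 = 0 := by linarith
  intro x hx
  have := (Finset.sum_eq_zero_iff_of_nonneg fun x _ => by positivity).1 e3 x
    (Finset.mem_compl.2 hx)
  simpa using this

open Matrix in
theorem sum_block_eq {X Y : Type*} [Fintype X] [DecidableEq X]
    [Fintype Y] [DecidableEq Y] (N : Finset X) (L : Finset Y)
    (γ : X → ℝ) (d : Y → ℝ)
    (Q : Matrix Y X ℂ) (hQ : Qᴴ * Q = 1)
    (h0 : ∀ y ∉ L, ∀ x ∈ N, Q y x = 0) (h1 : ∀ y ∈ L, ∀ x ∉ N, Q y x = 0)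
    (hM : ∀ y, (Q * diagonal (fun x => (γ x : ℂ)) * Qᴴ) y y = (d y : ℂ)) :
    ∑ y ∈ L, d y = ∑ x ∈ N, γ x := by
  have e1 : ∀ y ∈ L, d y = ∑ x ∈ N, γ x * ‖Q y x‖ ^ 2 := by
    intro y hy
    have := congrArg Complex.re (hM y)
    rw [Matrix.mul_apply, Complex.re_sum, Complex.ofReal_re] at this
    rw [← this, ← Finset.sum_subset (Finset.subset_univ N)
      (fun x _ hx => by simp [h1 y hy x hx])]
    refine Finset.sum_congr rfl fun x _ => ?_
    rw [Matrix.mul_diagonal, Matrix.conjTranspose_apply, mul_right_comm, mul_comm,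
      ← starRingEnd_apply, Complex.mul_conj', ← Complex.ofReal_pow, ← Complex.ofReal_mul,
      Complex.ofReal_re]
  rw [Finset.sum_congr rfl e1, Finset.sum_comm]
  refine Finset.sum_congr rfl fun x hx => ?_
  rw [← Finset.mul_sum]
  have := congrArg Complex.re (congrFun (congrFun hQ x) x)
  rw [Matrix.mul_apply, Complex.re_sum, Matrix.one_apply_eq,
    ← Finset.sum_subset (Finset.subset_univ L) (fun y _ hy => by simp [h0 y hy x hx])] at this
  have e2 : ∑ y ∈ L, ‖Q y x‖ ^ 2 = 1 := by
    simpa [Complex.conj_mul', ← Complex.ofReal_pow] using this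
  rw [e2, mul_one]

namespace IsPolynomialFun

variable {σ : Type*}

theorem matrix_mul {l m n : Type*} [Fintype m] {A : (σ → ℂ) → ℂ → Matrix l m ℂ}
    {B : (σ → ℂ) → ℂ → Matrix m n ℂ} (hA : ∀ i j, IsPolynomialFun fun z s => A z s i j)
    (hB : ∀ i j, IsPolynomialFun fun z s => B z s i j) (i : l) (j : n) :
    IsPolynomialFun fun z s => (A z s * B z s) i j := by
  simp only [Matrix.mul_apply]
  exact sum _ fun k => (hA i k).mul (hB k j)

theorem matrix_det {n : Type*} [Fintype n] [DecidableEq n] {A : (σ → ℂ) → ℂ → Matrix n n ℂ}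
    (hA : ∀ i j, IsPolynomialFun fun z s => A z s i j) :
    IsPolynomialFun fun z s => (A z s).det := by
  simp only [Matrix.det_apply']
  exact sum _ fun τ => (const _).mul (prod _ fun i => hA _ _)

theorem matrix_adjugate {n : Type*} [Fintype n] [DecidableEq n]
    {A : (σ → ℂ) → ℂ → Matrix n n ℂ} (hA : ∀ i j, IsPolynomialFun fun z s => A z s i j)
    (i j : n) : IsPolynomialFun fun z s => (A z s).adjugate i j := by
  simp only [Matrix.adjugate_apply]
  refine matrix_det fun a b => ?_
  simp only [Matrix.updateRow_apply]
  split_ifs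
  · exact const _
  · exact hA a b

end IsPolynomialFun

open Matrix ComplexOrder in
theorem det_one_sub_smul_ne_zero {X : Type*} [Fintype X] [DecidableEq X] (K : Matrix X X ℂ)
    (hK : Kᴴ = -K) (s : ℝ) : (1 - (s : ℂ) • K).det ≠ 0 := by
  have h1 : (1 - (s : ℂ) • K)ᴴ * (1 - (s : ℂ) • K) = 1 + ((s : ℂ) • K)ᴴ * ((s : ℂ) • K) := by
    have : ((s : ℂ) • K)ᴴ = -((s : ℂ) • K) := by simp [conjTranspose_smul, hK]
    rw [conjTranspose_sub, conjTranspose_one, this]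
    generalize (s : ℂ) • K = K'
    noncomm_ring
  have h2 : (1 + ((s : ℂ) • K)ᴴ * ((s : ℂ) • K)).PosDef :=
    Matrix.PosDef.one.add_posSemidef (Matrix.posSemidef_conjTranspose_mul_self _)
  have h3 := h2.det_pos.ne'
  rw [← h1, Matrix.det_mul] at h3
  exact right_ne_zero_of_mul h3

open Matrix in
theorem exists_unit_det_one_add_smul_ne_zero {X : Type*} [Fintype X] [DecidableEq X]
    (U : Matrix X X ℂ) : ∃ ζ : ℂ, ‖ζ‖ = 1 ∧ (1 + ζ • U).det ≠ 0 := by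
  have hfin : (spectrum ℂ U).Finite := Matrix.finite_spectrum U
  have hinf : (Metric.sphere (0 : ℂ) 1).Infinite := by
    refine IsPreconnected.infinite_of_nontrivial ?_ ?_
    · exact isPreconnected_sphere (by simp [Complex.rank_real_complex]) 0 1
    · exact ⟨1, by simp, -1, by simp, by norm_num⟩
  obtain ⟨μ, hμ, hμ'⟩ := (hinf.sdiff hfin).nonempty
  have hμ1 : ‖μ‖ = 1 := by simpa using hμ
  have hμ0 : μ ≠ 0 := by rintro rfl; simp at hμ1
  refine ⟨-μ⁻¹, by simp [hμ1], ?_⟩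
  have h1 : IsUnit (algebraMap ℂ (Matrix X X ℂ) μ - U) := by
    simpa [spectrum.mem_iff] using hμ'
  have h2 : 1 + (-μ⁻¹) • U = μ⁻¹ • (algebraMap ℂ (Matrix X X ℂ) μ - U) := by
    rw [smul_sub, Algebra.algebraMap_eq_smul_one, smul_smul, inv_mul_cancel₀ hμ0]
    simp [sub_eq_add_neg]
  rw [h2, Matrix.det_smul]
  exact mul_ne_zero (pow_ne_zero _ (inv_ne_zero hμ0)) ((Matrix.isUnit_iff_isUnit_det _).1 h1).ne_zero

open Matrix in
/-- Two unitary matrices are joined, up to a phase, by a continuous unitary path whose entries are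
polynomials up to a common nonvanishing factor. -/
theorem exists_polynomial_unitary_path (σ : Type*) {X Y : Type*} [Fintype X] [DecidableEq X]
    [Fintype Y] [DecidableEq Y] (Q₀ Q₁ : Matrix Y X ℂ) (h₀ : Q₀ᴴ * Q₀ = 1) (h₀' : Q₀ * Q₀ᴴ = 1)
    (h₁ : Q₁ᴴ * Q₁ = 1) :
    ∃ (P : ℂ → Matrix Y X ℂ) (Q : ℝ → Matrix Y X ℂ) (d : ℝ → ℂ) (ζ : ℂ),
      (∀ y x, IsPolynomialFun (σ := σ) fun _ s => P s y x) ∧ P 0 = Q₀ ∧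
      (∀ s : ℝ, d s ≠ 0 ∧ P s = d s • Q s ∧ (Q s)ᴴ * Q s = 1) ∧ Continuous Q ∧
      ‖ζ‖ = 1 ∧ Q 1 = ζ • Q₁ := by
  obtain ⟨ζ, hζ, hdet⟩ := exists_unit_det_one_add_smul_ne_zero (Q₀ᴴ * Q₁)
  obtain ⟨U, hU⟩ : ∃ U, U = ζ • (Q₀ᴴ * Q₁) := ⟨_, rfl⟩
  rw [← hU] at hdet
  have hζ' : star ζ * ζ = 1 := by
    rw [← starRingEnd_apply, Complex.conj_mul', hζ]; simp
  have hUU : Uᴴ * U = 1 := by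
    rw [hU, conjTranspose_smul, smul_mul_smul_comm, hζ', one_smul, conjTranspose_mul,
      conjTranspose_conjTranspose]
    calc Q₁ᴴ * Q₀ * (Q₀ᴴ * Q₁) = Q₁ᴴ * (Q₀ * Q₀ᴴ) * Q₁ := by simp only [Matrix.mul_assoc]
      _ = 1 := by rw [h₀', Matrix.mul_one, h₁]
  have hUU' : U * Uᴴ = 1 := mul_eq_one_comm.1 hUU
  have hunit : IsUnit (1 + U).det := hdet.isUnit
  obtain ⟨W, hW⟩ : ∃ W, W = (1 + U)⁻¹ := ⟨_, rfl⟩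
  have hW1 : (1 + U) * W = 1 := by rw [hW]; exact Matrix.mul_nonsing_inv _ hunit
  have hW2 : W * (1 + U) = 1 := by rw [hW]; exact Matrix.nonsing_inv_mul _ hunit
  obtain ⟨K, hKdef⟩ : ∃ K, K = (U - 1) * W := ⟨_, rfl⟩
  have hK : Kᴴ = -K := by
    have hWH : Wᴴ * (1 + Uᴴ) = 1 := by
      have := congrArg conjTranspose hW1
      simpa [conjTranspose_mul] using this
    have e1 : Kᴴ * (1 + U) = -(U - 1) := by
      have : 1 + U = (1 + Uᴴ) * U := by rw [Matrix.add_mul, hUU, Matrix.one_mul, add_comm]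
      rw [hKdef, conjTranspose_mul, conjTranspose_sub, conjTranspose_one]
      calc Wᴴ * (Uᴴ - 1) * (1 + U) = Wᴴ * ((Uᴴ - 1) * (1 + U)) := by rw [Matrix.mul_assoc]
        _ = Wᴴ * ((1 + Uᴴ) * (1 - U)) := by
          congr 1
          have : (Uᴴ - 1) * (1 + U) = Uᴴ + Uᴴ * U - 1 - U := by noncomm_ring
          rw [this, hUU]
          have : (1 + Uᴴ) * (1 - U) = 1 - U + Uᴴ - Uᴴ * U := by noncomm_ring
          rw [this, hUU]
          abel
        _ = -(U - 1) := by rw [← Matrix.mul_assoc, hWH, Matrix.one_mul, neg_sub]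
    calc Kᴴ = Kᴴ * ((1 + U) * W) := by rw [hW1, Matrix.mul_one]
      _ = -K := by rw [← Matrix.mul_assoc, e1, hKdef, Matrix.neg_mul]
  have hdet' := det_one_sub_smul_ne_zero K hK
  let P : ℂ → Matrix Y X ℂ := fun s => Q₀ * ((1 + s • K) * (1 - s • K).adjugate)
  let d : ℝ → ℂ := fun s => (1 - (s : ℂ) • K).det
  have hdc : Continuous d := by
    apply Continuous.matrix_det
    fun_prop
  have hPc : Continuous fun s : ℝ => P s := by
    have h1 : Continuous fun s : ℝ => (1 - (s : ℂ) • K).adjugate :=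
      Continuous.matrix_adjugate (by fun_prop)
    have h2 : Continuous fun s : ℝ => (1 + (s : ℂ) • K) := by fun_prop
    exact continuous_const.matrix_mul (h2.matrix_mul h1)
  have hadj : ∀ s : ℝ, (1 - (s : ℂ) • K).adjugate * (1 - (s : ℂ) • K) = d s • 1 :=
    fun s => Matrix.adjugate_mul _
  have hadj' : ∀ s : ℝ, (1 - (s : ℂ) • K) * (1 - (s : ℂ) • K).adjugate = d s • 1 :=
    fun s => Matrix.mul_adjugate _
  refine ⟨P, fun s => (d s)⁻¹ • P s, d, ζ, ?_, ?_, ?_, ?_, hζ, ?_⟩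
  · have hl : ∀ (ε : ℂ) (i j : X),
        IsPolynomialFun (σ := σ) fun _ s => (1 + ε • s • K) i j := by
      intro ε i j
      simp only [Matrix.add_apply, Matrix.smul_apply, smul_eq_mul]
      exact (IsPolynomialFun.const _).add ((IsPolynomialFun.const _).mul
        (IsPolynomialFun.param.mul (IsPolynomialFun.const _)))
    refine IsPolynomialFun.matrix_mul (fun _ _ => IsPolynomialFun.const _)
      (IsPolynomialFun.matrix_mul (fun i j => ?_) (IsPolynomialFun.matrix_adjugate fun i j => ?_))
    · simpa using hl 1 i j
    · simpa [sub_eq_add_neg] using hl (-1) i j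
  · simp [P]
  · intro s
    have hd : d s ≠ 0 := hdet' s
    refine ⟨hd, by simp [smul_smul, hd], ?_⟩
    obtain ⟨B, hB⟩ : ∃ B, B = (1 - (s : ℂ) • K).adjugate := ⟨_, rfl⟩
    have hsK : ((s : ℂ) • K)ᴴ = -((s : ℂ) • K) := by simp [conjTranspose_smul, hK]
    have e1 : (1 - (s : ℂ) • K)ᴴ = 1 + (s : ℂ) • K := by
      rw [conjTranspose_sub, conjTranspose_one, hsK, sub_neg_eq_add]
    have e2 : (1 + (s : ℂ) • K)ᴴ = 1 - (s : ℂ) • K := by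
      rw [conjTranspose_add, conjTranspose_one, hsK, sub_eq_add_neg]
    have e3 : Bᴴ * (1 + (s : ℂ) • K) = star (d s) • 1 := by
      have := congrArg conjTranspose (hadj' s)
      rw [conjTranspose_mul, e1, conjTranspose_smul, conjTranspose_one] at this
      rw [hB, this]
    have e4 : (1 - (s : ℂ) • K) * (1 + (s : ℂ) • K) = (1 + (s : ℂ) • K) * (1 - (s : ℂ) • K) := by
      generalize (s : ℂ) • K = K'
      noncomm_ring
    change ((d s)⁻¹ • (Q₀ * ((1 + (s : ℂ) • K) * (1 - (s : ℂ) • K).adjugate)))ᴴ *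
      ((d s)⁻¹ • (Q₀ * ((1 + (s : ℂ) • K) * (1 - (s : ℂ) • K).adjugate))) = 1
    rw [← hB, conjTranspose_smul, Matrix.smul_mul, Matrix.mul_smul, smul_smul, conjTranspose_mul, conjTranspose_mul, e2]
    have e5 : Bᴴ * (1 - (s : ℂ) • K) * Q₀ᴴ * (Q₀ * ((1 + (s : ℂ) • K) * B)) =
        (star (d s) * d s) • 1 := by
      calc _ = Bᴴ * (1 - (s : ℂ) • K) * (Q₀ᴴ * Q₀) * ((1 + (s : ℂ) • K) * B) := by
            simp only [Matrix.mul_assoc]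
        _ = Bᴴ * ((1 - (s : ℂ) • K) * (1 + (s : ℂ) • K)) * B := by
            rw [h₀, Matrix.mul_one]; simp only [Matrix.mul_assoc]
        _ = (Bᴴ * (1 + (s : ℂ) • K)) * ((1 - (s : ℂ) • K) * B) := by
            rw [e4]; simp only [Matrix.mul_assoc]
        _ = _ := by
            rw [e3, hB, hadj' s, smul_mul_smul_comm, Matrix.one_mul]
    rw [e5, smul_smul]
    have : star (d s)⁻¹ * (d s)⁻¹ * (star (d s) * d s) = 1 := by
      rw [star_inv₀]
      have : star (d s) ≠ 0 := star_ne_zero.2 hd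
      field_simp
    rw [this, one_smul]
  · exact (hdc.inv₀ hdet').smul hPc
  · have hd : d 1 ≠ 0 := hdet' 1
    have e1 : (1 - K) = (2 : ℂ) • W := by
      have : (1 - K) = ((1 + U) - (U - 1)) * W := by rw [Matrix.sub_mul, hW1, hKdef]
      rw [this, two_smul, ← two_mul]
      congr 1
      rw [← one_add_one_eq_two]
      abel
    have e2 : (1 + K) = (2 : ℂ) • (U * W) := by
      have : (1 + K) = ((1 + U) + (U - 1)) * W := by rw [Matrix.add_mul, hW1, hKdef]
      rw [this, ← Matrix.smul_mul]
      congr 1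
      rw [two_smul]
      abel
    have e3 : (1 + K) * (1 - K).adjugate = d 1 • U := by
      have h3 := hadj' 1
      rw [Complex.ofReal_one, one_smul] at h3
      have : 1 + K = U * (1 - K) := by rw [e1, e2, Matrix.mul_smul]
      rw [this, Matrix.mul_assoc, h3, Matrix.mul_smul, Matrix.mul_one]
    change (d 1)⁻¹ • (Q₀ * ((1 + ((1 : ℝ) : ℂ) • K) * (1 - ((1 : ℝ) : ℂ) • K).adjugate)) = ζ • Q₁
    rw [Complex.ofReal_one, one_smul, e3, Matrix.mul_smul, smul_smul, inv_mul_cancel₀ hd, one_smul,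
      hU, Matrix.mul_smul, ← Matrix.mul_assoc, h₀', Matrix.one_mul]

/-- The matrix with entries `z` at the positions in `S` and zero elsewhere. -/
def Matrix.ofSupport {a b : Type*} [DecidableEq a] [DecidableEq b] (S : Finset (a × b))
    (z : S → ℂ) : Matrix a b ℂ :=
  fun i j => if h : (i, j) ∈ S then z ⟨(i, j), h⟩ else 0

namespace Matrix

variable {a b : Type*} [DecidableEq a] [DecidableEq b] {S : Finset (a × b)}

theorem ofSupport_ne_zero {z : S → ℂ} {i : a} {j : b} (h : ofSupport S z i j ≠ 0) :
    (i, j) ∈ S := by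
  by_contra h'
  exact h (by simp [ofSupport, h'])

theorem ofSupport_smul (t : ℂ) (z : S → ℂ) : ofSupport S (t • z) = t • ofSupport S z := by
  ext i j
  by_cases h : (i, j) ∈ S <;> simp [ofSupport, h]

theorem ofSupport_add (z z' : S → ℂ) :
    ofSupport S (z + z') = ofSupport S z + ofSupport S z' := by
  ext i j
  by_cases h : (i, j) ∈ S <;> simp [ofSupport, h]

theorem eq_zero_of_ofSupport_eq_zero {z : S → ℂ} (h : ofSupport S z = 0) : z = 0 := by
  funext t
  have := congrFun (congrFun h t.1.1) t.1.2
  simpa [ofSupport] using this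

theorem isPolynomialFun_ofSupport {σ : Type*} (f : S → σ) (i : a) (j : b) :
    IsPolynomialFun (σ := σ) fun z _ => ofSupport S (fun t => z (f t)) i j := by
  by_cases h : (i, j) ∈ S
  · simp only [ofSupport, h, dite_true]
    exact IsPolynomialFun.coord _
  · simp only [ofSupport, h, dite_false]
    exact IsPolynomialFun.const _

end Matrix

open Matrix Filter Topology in
theorem sum_le_of_critical_frame {X Y ι : Type*} [Fintype X] [DecidableEq X]
    [Fintype Y] [DecidableEq Y] [DecidableEq ι] (π : Y → ι) (γ : X → ℝ) (c h : Y → ℝ)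
    (Q₀ Q₁ : Matrix Y X ℂ) (h₀ : Q₀ᴴ * Q₀ = 1) (h₀' : Q₀ * Q₀ᴴ = 1)
    (h₁ : Q₁ᴴ * Q₁ = 1)
    (N : Finset X) (L : Finset Y) (hcard : N.card = L.card)
    (h0 : ∀ y ∉ L, ∀ x ∈ N, Q₀ y x = 0)
    (hh : ∀ y ∈ L, ∀ y' ∉ L, h y' < h y)
    (hM : ∀ y y', π y = π y' → (Q₀ * diagonal (fun x => (γ x : ℂ)) * Q₀ᴴ) y y' =
      diagonal (fun y => ((c y - h y : ℝ) : ℂ)) y y')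
    (hcount : N.card * Lᶜ.card ≤
      (Finset.univ.filter fun t : X × X => t.1 ∉ N ∧ t.2 ∈ N ∧ γ t.1 < γ t.2).card +
      (Finset.univ.filter fun t : Y × Y => t.1 ∉ L ∧ t.2 ∈ L ∧ π t.1 = π t.2 ∧ c t.2 ≤ c t.1).card) :
    ∑ y ∈ L, h y ≤ L.card * ∑ y, ∑ y', if π y = π y' then
      ‖(Q₁ * diagonal (fun x => (γ x : ℂ)) * Q₁ᴴ - diagonal (fun y => (c y : ℂ))) y y'‖ else 0 := by
  obtain ⟨SU, hSU⟩ : ∃ S : Finset (X × X),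
    S = (Finset.univ.filter fun t : X × X => t.1 ∉ N ∧ t.2 ∈ N ∧ γ t.1 < γ t.2) := ⟨_, rfl⟩
  obtain ⟨SΦ, hSΦ⟩ : ∃ S : Finset (Y × Y),
    S = (Finset.univ.filter fun t : Y × Y => t.1 ∉ L ∧ t.2 ∈ L ∧ π t.1 = π t.2 ∧ c t.2 ≤ c t.1) := ⟨_, rfl⟩
  rw [← hSU, ← hSΦ] at hcount
  have hSUm : ∀ {q x}, (q, x) ∈ SU → q ∉ N ∧ x ∈ N ∧ γ q < γ x := by
    intro q x hqx; simpa [hSU] using hqx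
  have hSΦm : ∀ {y' y}, (y', y) ∈ SΦ → y' ∉ L ∧ y ∈ L ∧ π y' = π y ∧ c y ≤ c y' := by
    intro q x hqx; simpa [hSΦ] using hqx
  have h0' := apply_eq_zero_of_block_triangular N L hcard Q₀ h₀ h₀' h0
  obtain ⟨P, Q, d, ζ, hP, hP0, hQ, hQc, hζ, hQ1⟩ :=
    exists_polynomial_unitary_path (SU ⊕ SΦ) Q₀ Q₁ h₀ h₀' h₁
  let U : (SU ⊕ SΦ → ℂ) → Matrix X X ℂ := fun z => ofSupport SU fun t => z (Sum.inl t)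
  let Φ : (SU ⊕ SΦ → ℂ) → Matrix Y Y ℂ := fun z => ofSupport SΦ fun t => z (Sum.inr t)
  have hU : ∀ z q x, U z q x ≠ 0 → q ∉ N ∧ x ∈ N ∧ γ q < γ x :=
    fun z q x hne => hSUm (ofSupport_ne_zero hne)
  have hΦ : ∀ z y' y, Φ z y' y ≠ 0 → y' ∉ L ∧ y ∈ L ∧ π y' = π y ∧ c y ≤ c y' :=
    fun z q x hne => hSΦm (ofSupport_ne_zero hne)
  let G : (SU ⊕ SΦ → ℂ) → ℂ → Matrix Y X ℂ := fun z s => (1 - Φ z) * P s * (1 + U z)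
  have hUs : ∀ (t : ℂ) z, U (t • z) = t • U z := fun t z => ofSupport_smul t _
  have hΦs : ∀ (t : ℂ) z, Φ (t • z) = t • Φ z := fun t z => ofSupport_smul t _
  have hfin := finite_setOf_not_solvable_of_linearization
    (σ := SU ⊕ SΦ) (ε := {y // y ∉ L} × {x // x ∈ N})
    (fun e z s => G z s e.1 e.2)
    (by
      intro e
      refine IsPolynomialFun.matrix_mul (IsPolynomialFun.matrix_mul (fun i j => ?_) hP)
        (fun i j => ?_) _ _
      · simp only [Matrix.sub_apply]
        exact (IsPolynomialFun.const _).sub (isPolynomialFun_ofSupport _ _ _)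
      · simp only [Matrix.add_apply]
        exact (IsPolynomialFun.const _).add (isPolynomialFun_ofSupport _ _ _))
    (by
      have e1 : Fintype.card {y // y ∉ L} = Lᶜ.card := by
        rw [Fintype.card_subtype]; congr 1; ext; simp
      rw [Fintype.card_prod, Fintype.card_sum, e1, Fintype.card_coe, Fintype.card_coe,
        Fintype.card_coe, mul_comm]
      exact hcount)
    (fun e z => (Q₀ * U z - Φ z * Q₀) e.1 e.2) (fun e z => -(Φ z * Q₀ * U z) e.1 e.2)
    (by
      intro e z t
      simp only [G, hP0, hUs, hΦs]
      have : (1 - t • Φ z) * Q₀ * (1 + t • U z) =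
          Q₀ + t • (Q₀ * U z - Φ z * Q₀) + t ^ 2 • (-(Φ z * Q₀ * U z)) := by
        simp only [Matrix.mul_add, Matrix.sub_mul, Matrix.mul_one, Matrix.one_mul, Matrix.smul_mul,
          Matrix.mul_smul, smul_smul, smul_sub, smul_neg, sq]
        abel
      rw [this]
      simp [h0 e.1 e.1.2 e.2 e.2.2])
    (by
      intro z hz
      have heq : Q₀ * U z = Φ z * Q₀ := by
        ext y x
        by_cases hx : x ∈ N
        · by_cases hy : y ∈ L
          · rw [Matrix.mul_apply, Matrix.mul_apply, Finset.sum_eq_zero, Finset.sum_eq_zero]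
            · intro y' _
              have : Φ z y y' = 0 := by
                by_contra hne; exact (hΦ z _ _ hne).1 hy
              rw [this, zero_mul]
            · intro q _
              by_cases hne : U z q x = 0
              · rw [hne, mul_zero]
              · rw [h0' y hy q (hU z _ _ hne).1, zero_mul]
          · exact sub_eq_zero.1 (hz (⟨y, hy⟩, ⟨x, hx⟩))
        · rw [Matrix.mul_apply, Matrix.mul_apply, Finset.sum_eq_zero, Finset.sum_eq_zero]
          · intro y' _
            by_cases hne : Φ z y y' = 0
            · rw [hne, zero_mul]
            · rw [h0' y' (hΦ z _ _ hne).2.1 x hx, mul_zero]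
          · intro q _
            have : U z q x = 0 := by
              by_contra hne; exact hx (hU z _ _ hne).2.1
            rw [this, mul_zero]
      obtain ⟨r1, r2⟩ := eq_zero_of_intertwine π γ c h Q₀ h₀ h₀' hM (U z)
        (fun q x hne => (hU z q x hne).2.2) (Φ z)
        (fun y' y hne => ⟨(hΦ z _ _ hne).2.2.1, (hΦ z _ _ hne).2.2.2,
          hh y (hΦ z _ _ hne).2.1 y' (hΦ z _ _ hne).1⟩) heq
      have r1' := eq_zero_of_ofSupport_eq_zero r1
      have r2' := eq_zero_of_ofSupport_eq_zero r2
      funext t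
      cases t with
      | inl t => exact congrFun r1' t
      | inr t => exact congrFun r2' t)
  have hsum : ∑ y ∈ L, (c y - h y) = ∑ x ∈ N, γ x :=
    sum_block_eq N L γ (fun y => c y - h y) Q₀ h₀ h0 h0' (fun y => by
      rw [hM y y rfl, diagonal_apply_eq])
  let E : ℝ → ℝ := fun s => L.card * ∑ y, ∑ y', if π y = π y' then
      ‖(Q s * diagonal (fun x => (γ x : ℂ)) * (Q s)ᴴ - diagonal (fun y => (c y : ℂ))) y y'‖ else 0
  have hgood : ∀ s : ℝ, (∃ z, ∀ e : {y // y ∉ L} × {x // x ∈ N},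
      G z s e.1 e.2 = 0) → ∑ y ∈ L, h y ≤ E s := by
    rintro s ⟨z, hz⟩
    obtain ⟨hd, hPQ, hQs⟩ := hQ s
    have hΦΦ : Φ z * Φ z = 0 := by
      ext y y'
      rw [Matrix.mul_apply, Finset.sum_eq_zero, Matrix.zero_apply]
      intro k _
      by_cases hne : Φ z y k = 0
      · rw [hne, zero_mul]
      · have : Φ z k y' = 0 := by
          by_contra hne'
          exact (hΦ z _ _ hne').1 (hΦ z _ _ hne).2.1
        rw [this, mul_zero]
    obtain ⟨W, hW⟩ : ∃ W, W = (1 - Φ z) * Q s * (1 + U z) := ⟨_, rfl⟩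
    have hW0 : ∀ y ∉ L, ∀ x ∈ N, W y x = 0 := by
      intro y hy x hx
      have := hz (⟨y, hy⟩, ⟨x, hx⟩)
      simp only [G] at this
      rw [hPQ, Matrix.mul_smul, Matrix.smul_mul, ← hW, Matrix.smul_apply, smul_eq_mul] at this
      exact (mul_eq_zero.1 this).resolve_left hd
    have hQW : Q s * (1 + U z) = (1 + Φ z) * W := by
      have : (1 + Φ z) * (1 - Φ z) = 1 := by
        have : (1 + Φ z) * (1 - Φ z) = 1 - Φ z * Φ z := by noncomm_ring
        rw [this, hΦΦ, sub_zero]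
      rw [hW, Matrix.mul_assoc (1 - Φ z), ← Matrix.mul_assoc, this, Matrix.one_mul]
    have key := sum_sub_sum_le_of_frames (N := N) (L := L) (by simpa using hcard) γ c π
      (fun x => γ x) (fun y => c y) (fun y => π y) (Q s) hQs
      ((1 + U z).submatrix id (↑)) ((1 : Matrix X X ℂ).submatrix (↑) id)
      (by
        rw [← Matrix.submatrix_mul _ _ _ _ _ Function.bijective_id, Matrix.one_mul]
        ext x x'
        have : U z x x' = 0 := by
          by_contra hne; exact (hU z _ _ hne).1 x.2
        change (1 : Matrix X X ℂ) x x' + U z x x' = (1 : Matrix N N ℂ) x x'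
        rw [this, add_zero, Matrix.one_apply, Matrix.one_apply]
        simp only [Subtype.coe_inj])
      (by
        intro q x hne
        by_cases hqx : q = x
        · rw [hqx]
        · refine (hU z q x fun h => hne ?_).2.2.le
          simp [h, Matrix.one_apply_ne hqx])
      ((1 + Φ z).submatrix id (↑)) ((1 : Matrix Y Y ℂ).submatrix (↑) id)
      (by
        rw [← Matrix.submatrix_mul _ _ _ _ _ Function.bijective_id, Matrix.one_mul]
        ext x x'
        have : Φ z x x' = 0 := by
          by_contra hne; exact (hΦ z _ _ hne).1 x.2
        change (1 : Matrix Y Y ℂ) x x' + Φ z x x' = (1 : Matrix L L ℂ) x x'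
        rw [this, add_zero, Matrix.one_apply, Matrix.one_apply]
        simp only [Subtype.coe_inj])
      (by
        intro y' y hne
        by_cases hyy : y' = y
        · rw [hyy]; exact ⟨rfl, le_rfl⟩
        · refine (hΦ z y' y fun h => hne ?_).2.2
          simp [h, Matrix.one_apply_ne hyy])
      (W.submatrix (↑) (↑))
      (by
        ext y x
        have := congrFun (congrFun hQW y) x
        rw [Matrix.mul_apply, Matrix.mul_apply] at this
        rw [Matrix.mul_apply, Matrix.mul_apply]
        simp only [Matrix.submatrix_apply, id]
        rw [this, ← Finset.sum_subset (Finset.subset_univ L)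
          (fun y' _ hy' => by rw [hW0 y' hy' x x.2, mul_zero]), ← Finset.sum_coe_sort L])
    rw [Finset.sum_coe_sort N γ, Finset.sum_coe_sort L c, Fintype.card_coe] at key
    rw [Finset.sum_sub_distrib] at hsum
    refine le_trans (le_of_eq ?_) key
    linarith
  have hEc : Continuous E := by
    have h1 : Continuous fun s => Q s * diagonal (fun x => (γ x : ℂ)) * (Q s)ᴴ -
        diagonal (fun y => (c y : ℂ)) :=
      ((hQc.matrix_mul continuous_const).matrix_mul hQc.matrix_conjTranspose).sub continuous_const
    refine continuous_const.mul (continuous_finsetSum _ fun y _ => continuous_finsetSum _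
      fun y' _ => ?_)
    split_ifs
    · exact (h1.matrix_elem y y').norm
    · exact continuous_const
  have hE1 : E 1 = L.card * ∑ y, ∑ y', if π y = π y' then
      ‖(Q₁ * diagonal (fun x => (γ x : ℂ)) * Q₁ᴴ - diagonal (fun y => (c y : ℂ))) y y'‖ else 0 := by
    have hζ' : ζ * star ζ = 1 := by
      rw [← starRingEnd_apply, Complex.mul_conj', hζ]; simp
    have : Q 1 * diagonal (fun x => (γ x : ℂ)) * (Q 1)ᴴ =
        Q₁ * diagonal (fun x => (γ x : ℂ)) * Q₁ᴴ := by
      rw [hQ1, conjTranspose_smul, Matrix.mul_smul, Matrix.smul_mul, Matrix.smul_mul, smul_smul,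
        mul_comm, hζ', one_smul]
    simp only [E, this]
  rw [← hE1]
  have hbad : {s : ℝ | ¬ ∃ z, ∀ e : {y // y ∉ L} × {x // x ∈ N},
      G z s e.1 e.2 = 0}.Finite :=
    hfin.preimage (f := fun s : ℝ => (s : ℂ)) Complex.ofReal_injective.injOn
  have hev : ∀ᶠ s in 𝓝[≠] (1 : ℝ), ∑ y ∈ L, h y ≤ E s := by
    have := (hbad.subset Set.sdiff_subset : ({s : ℝ | ¬ ∃ z, ∀ e : {y // y ∉ L} × {x // x ∈ N},
      G z s e.1 e.2 = 0} \ {1}).Finite).isClosed.isOpen_compl.mem_nhds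
        (x := 1) (by simp)
    filter_upwards [mem_nhdsWithin_of_mem_nhds this, self_mem_nhdsWithin] with s hs hs1
    refine hgood s ?_
    by_contra hcon
    exact hs ⟨hcon, hs1⟩
  exact ge_of_tendsto (hEc.continuousAt.tendsto.mono_left nhdsWithin_le_nhds) hev

theorem two_mul_card_inversions_add {X : Type*} [Fintype X] [DecidableEq X] {n : ℕ}
    (e : X ≃ Fin n) (S : Finset X) :
    2 * (Finset.univ.filter fun t : X × X => t.1 ∈ S ∧ t.2 ∉ S ∧ e t.2 < e t.1).card
      + S.card ^ 2 = 2 * ∑ x ∈ S, (e x : ℕ) + S.card := by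
  have h1 : ∀ x, (e x : ℕ) = (Finset.univ.filter fun y => e y < e x).card := by
    intro x
    have : (Finset.univ.filter fun y => e y < e x) = (Finset.Iio (e x)).map e.symm.toEmbedding := by
      ext y; simp
    rw [this, Finset.card_map, Fin.card_Iio]
  have h2 : ∑ x ∈ S, (e x : ℕ) =
      (Finset.univ.filter fun t : X × X => t.1 ∈ S ∧ t.2 ∉ S ∧ e t.2 < e t.1).card +
      (Finset.univ.filter fun t : X × X => t.1 ∈ S ∧ t.2 ∈ S ∧ e t.2 < e t.1).card := by
    have : ∑ x ∈ S, (e x : ℕ) =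
        (Finset.univ.filter fun t : X × X => t.1 ∈ S ∧ e t.2 < e t.1).card := by
      rw [Finset.card_filter, ← Finset.univ_product_univ, Finset.sum_product,
        ← Finset.sum_subset (Finset.subset_univ S) (fun x _ hx => by simp [hx])]
      refine Finset.sum_congr rfl fun x hx => ?_
      rw [h1, Finset.card_filter]
      simp [hx]
    rw [this, ← Finset.card_union_of_disjoint]
    · congr 1; ext t; simp; tauto
    · rw [Finset.disjoint_filter]; tauto
  have h3 : S.card ^ 2 = 2 *
      (Finset.univ.filter fun t : X × X => t.1 ∈ S ∧ t.2 ∈ S ∧ e t.2 < e t.1).card + S.card := by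
    have hswap : (Finset.univ.filter fun t : X × X => t.1 ∈ S ∧ t.2 ∈ S ∧ e t.1 < e t.2).card =
        (Finset.univ.filter fun t : X × X => t.1 ∈ S ∧ t.2 ∈ S ∧ e t.2 < e t.1).card := by
      refine Finset.card_equiv (Equiv.prodComm X X) ?_
      intro t; simp; tauto
    have hoff := Finset.offDiag_card S
    have : S.offDiag =
        (Finset.univ.filter fun t : X × X => t.1 ∈ S ∧ t.2 ∈ S ∧ e t.1 < e t.2) ∪
        (Finset.univ.filter fun t : X × X => t.1 ∈ S ∧ t.2 ∈ S ∧ e t.2 < e t.1) := by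
      ext t
      simp only [Finset.mem_offDiag, Finset.mem_union, Finset.mem_filter, Finset.mem_univ, true_and]
      have : t.1 ≠ t.2 ↔ (e t.1 < e t.2 ∨ e t.2 < e t.1) := by
        rw [← lt_or_lt_iff_ne.trans e.injective.ne_iff]
      tauto
    rw [this, Finset.card_union_of_disjoint, hswap] at hoff
    · have : S.card ≤ S.card * S.card := Nat.le_mul_self _
      rw [sq]; omega
    · rw [Finset.disjoint_filter]
      rintro t - ⟨_, _, h⟩ ⟨_, _, h'⟩
      exact lt_asymm h h'
  omega

theorem card_inversions_interleave {p m r : ℕ} (I : Fin m → Finset (Fin p))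
    (hI : ∀ i, (I i).card = r) :
    (Finset.univ.filter fun t : (Fin p × Fin m) × (Fin p × Fin m) => t.1.1 ∈ I t.1.2 ∧
      t.2.1 ∉ I t.2.2 ∧ finProdFinEquiv t.2 < finProdFinEquiv t.1).card =
    m * ∑ i, (Finset.univ.filter fun t : Fin p × Fin p =>
      t.1 ∈ I i ∧ t.2 ∉ I i ∧ t.2 < t.1).card := by
  let S : Finset (Fin p × Fin m) := Finset.univ.filter fun x => x.1 ∈ I x.2
  have hS : ∀ f : Fin p × Fin m → ℕ, ∑ x ∈ S, f x = ∑ i, ∑ k ∈ I i, f (k, i) := by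
    intro f
    rw [Finset.sum_filter, ← Finset.univ_product_univ, Finset.sum_product_right]
    refine Finset.sum_congr rfl fun i _ => ?_
    rw [← Finset.sum_filter]
    simp
  have hScard : S.card = m * r := by
    rw [Finset.card_eq_sum_ones, hS]
    simp [hI]
  have h1 := two_mul_card_inversions_add finProdFinEquiv S
  have h2 : ∀ i, 2 * (Finset.univ.filter fun t : Fin p × Fin p =>
      t.1 ∈ I i ∧ t.2 ∉ I i ∧ t.2 < t.1).card + r ^ 2 = 2 * ∑ x ∈ I i, (x : ℕ) + r := by
    intro i
    have := two_mul_card_inversions_add (Equiv.refl (Fin p)) (I i)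
    rw [hI] at this
    exact this
  rw [hScard, hS] at h1
  have hT : (Finset.univ.filter fun t : (Fin p × Fin m) × (Fin p × Fin m) => t.1 ∈ S ∧
      t.2 ∉ S ∧ finProdFinEquiv t.2 < finProdFinEquiv t.1) =
      Finset.univ.filter fun t : (Fin p × Fin m) × (Fin p × Fin m) => t.1.1 ∈ I t.1.2 ∧
      t.2.1 ∉ I t.2.2 ∧ finProdFinEquiv t.2 < finProdFinEquiv t.1 := by
    ext t; simp [S]
  rw [hT] at h1
  have h3 : ∑ i : Fin m, ∑ k ∈ I i, (finProdFinEquiv (k, i) : ℕ) =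
      r * (∑ i : Fin m, (i : ℕ)) + m * ∑ i, ∑ k ∈ I i, (k : ℕ) := by
    simp only [finProdFinEquiv_apply_val, Finset.sum_add_distrib, Finset.mul_sum, Finset.sum_const,
      hI, smul_eq_mul]
  have h4 : (∑ i : Fin m, (i : ℕ)) * 2 + m = m * m := by
    rw [Fin.sum_univ_eq_sum_range (fun i => i), Finset.sum_range_id_mul_two]
    cases m with
    | zero => simp
    | succ m => simp; ring
  have h5 := Finset.sum_congr rfl (fun i (_ : i ∈ Finset.univ) => h2 i)
  simp only [Finset.sum_add_distrib, ← Finset.mul_sum, Finset.sum_const, Finset.card_univ,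
    Fintype.card_fin, smul_eq_mul] at h5
  rw [h3] at h1
  generalize (∑ i : Fin m, (i : ℕ)) = a at *
  generalize (∑ i, ∑ k ∈ I i, (k : ℕ)) = b at *
  generalize (∑ i, (Finset.univ.filter fun t : Fin p × Fin p =>
      t.1 ∈ I i ∧ t.2 ∉ I i ∧ t.2 < t.1).card) = n at *
  generalize (Finset.univ.filter fun t : (Fin p × Fin m) × (Fin p × Fin m) => t.1.1 ∈ I t.1.2 ∧
      t.2.1 ∉ I t.2.2 ∧ finProdFinEquiv t.2 < finProdFinEquiv t.1).card = T at *
  nlinarith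

/-- Second order necessary condition for a minimum. -/
theorem nonneg_of_isMin_of_hasDerivAt {g g' : ℝ → ℝ} {g'' : ℝ} (hg : ∀ t, HasDerivAt g (g' t) t)
    (hg' : HasDerivAt g' g'' 0) (hmin : ∀ t, g 0 ≤ g t) : g' 0 = 0 ∧ 0 ≤ g'' := by
  have h0 : g' 0 = 0 := by
    have : IsLocalMin g 0 := Filter.Eventually.of_forall hmin
    exact this.hasDerivAt_eq_zero (hg 0)
  refine ⟨h0, ?_⟩
  by_contra! hneg
  let φ : ℝ → ℝ := fun t => g'' / 4 * t ^ 2 - g t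
  have hφ : ∀ t, HasDerivAt φ (g'' / 2 * t - g' t) t := by
    intro t
    refine ((((hasDerivAt_id t).pow 2).const_mul (g'' / 4)).sub (hg t)).congr_deriv ?_
    simp only [id]
    ring
  have hd : deriv φ = fun t => g'' / 2 * t - g' t := funext fun t => (hφ t).deriv
  have hd2 : deriv (deriv φ) 0 = - g'' / 2 := by
    rw [hd]
    refine ((((hasDerivAt_id (0 : ℝ)).const_mul (g'' / 2)).sub hg').congr_deriv ?_).deriv
    ring
  have hloc : IsLocalMin φ 0 := isLocalMin_of_deriv_deriv_pos (by rw [hd2]; linarith)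
    (by rw [hd]; simp [h0]) (hφ 0).continuousAt
  obtain ⟨ε, hε, hball⟩ := Metric.eventually_nhds_iff.1 hloc
  have h1 := @hball (ε / 2) (by rw [Real.dist_eq, sub_zero, abs_of_pos] <;> linarith)
  have h2 := hmin (ε / 2)
  simp only [φ] at h1
  nlinarith [mul_pos_of_neg_of_neg hneg hneg, sq_pos_of_pos hε]

section Variation

open Matrix
attribute [local instance] Matrix.linftyOpNormedRing Matrix.linftyOpNormedAlgebra

theorem hasDerivAt_conj_exp {n : Type*} [Fintype n] [DecidableEq n] (X A : Matrix n n ℂ) (t : ℝ) :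
    HasDerivAt (fun t : ℝ => NormedSpace.exp (t • X) * A * NormedSpace.exp (t • (-X)))
      (⁅X, NormedSpace.exp (t • X) * A * NormedSpace.exp (t • (-X))⁆) t := by
  have h1 : HasDerivAt (fun t : ℝ => NormedSpace.exp (t • X)) (X * NormedSpace.exp (t • X)) t :=
    hasDerivAt_exp_smul_const' X t
  have h2 : HasDerivAt (fun t : ℝ => NormedSpace.exp (t • (-X)))
      (NormedSpace.exp (t • (-X)) * (-X)) t := hasDerivAt_exp_smul_const (-X) t
  refine ((h1.mul_const A).mul h2).congr_deriv ?_
  rw [Ring.lie_def]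
  noncomm_ring

theorem exp_smul_skew {n : Type*} [Fintype n] [DecidableEq n] (X : Matrix n n ℂ) (hX : Xᴴ = -X)
    (t : ℝ) : (NormedSpace.exp (t • X))ᴴ = NormedSpace.exp (t • (-X)) ∧
      (NormedSpace.exp (t • X))ᴴ * NormedSpace.exp (t • X) = 1 := by
  have h1 : (NormedSpace.exp (t • X))ᴴ = NormedSpace.exp (t • (-X)) := by
    rw [← Matrix.exp_conjTranspose, conjTranspose_smul, hX, star_trivial]
  refine ⟨h1, ?_⟩
  rw [h1, ← Matrix.exp_add_of_commute]
  · simp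
  · exact ((Commute.refl X).neg_left.smul_left t).smul_right t

/-- First and second variation of the squared distance from `C` to a sum of orbits. -/
theorem variation_of_isMin {n ι : Type*} [Fintype n] [DecidableEq n] [Fintype ι] (C : Matrix n n ℂ)
    (A : ι → Matrix n n ℂ) (X : ι → Matrix n n ℂ) (hX : ∀ i, (X i)ᴴ = -X i)
    (hmin : ∀ W : ι → Matrix n n ℂ, (∀ i, (W i)ᴴ * W i = 1) →
      ((C - ∑ i, A i) * (C - ∑ i, A i)).trace.re ≤
      ((C - ∑ i, W i * A i * (W i)ᴴ) * (C - ∑ i, W i * A i * (W i)ᴴ)).trace.re) :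
    ((C - ∑ i, A i) * ∑ i, ⁅X i, A i⁆).trace.re = 0 ∧
    0 ≤ ((∑ i, ⁅X i, A i⁆) * ∑ i, ⁅X i, A i⁆).trace.re -
      ((C - ∑ i, A i) * ∑ i, ⁅X i, ⁅X i, A i⁆⁆).trace.re := by
  let B : ι → ℝ → Matrix n n ℂ :=
    fun i t => NormedSpace.exp (t • X i) * A i * NormedSpace.exp (t • (-X i))
  have hB0 : ∀ i, B i 0 = A i := fun i => by simp [B]
  have hB : ∀ i t, HasDerivAt (B i) ⁅X i, B i t⁆ t := fun i t => hasDerivAt_conj_exp (X i) (A i) t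
  let H : ℝ → Matrix n n ℂ := fun t => C - ∑ i, B i t
  let S : ℝ → Matrix n n ℂ := fun t => ∑ i, ⁅X i, B i t⁆
  have hH : ∀ t, HasDerivAt H (-S t) t := fun t =>
    (HasDerivAt.fun_sum fun i _ => hB i t).const_sub C
  have hS : ∀ t, HasDerivAt S (∑ i, ⁅X i, ⁅X i, B i t⁆⁆) t := fun t =>
    HasDerivAt.fun_sum fun i _ => by
      simp only [Ring.lie_def (X i)]
      have := hB i t
      simp only [Ring.lie_def (X i)] at this
      exact (this.const_mul (X i)).sub (this.mul_const (X i))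
  let τ : Matrix n n ℂ →L[ℝ] ℝ := LinearMap.toContinuousLinearMap
    (Complex.reLm ∘ₗ (Matrix.traceLinearMap n ℝ ℂ))
  have hg : ∀ t, HasDerivAt (fun t => (H t * H t).trace.re) (-2 * (H t * S t).trace.re) t := by
    intro t
    refine (τ.hasFDerivAt.comp_hasDerivAt t ((hH t).mul (hH t))).congr_deriv ?_
    change (-S t * H t + H t * -S t).trace.re = _
    rw [Matrix.mul_neg, Matrix.neg_mul, Matrix.trace_add, Matrix.trace_neg, Matrix.trace_neg,
      Matrix.trace_mul_comm (S t), Complex.add_re, Complex.neg_re]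
    ring
  have hg' : HasDerivAt (fun t => -2 * (H t * S t).trace.re)
      (-2 * (-S 0 * S 0 + H 0 * ∑ i, ⁅X i, ⁅X i, B i 0⁆⁆).trace.re) 0 :=
    (τ.hasFDerivAt.comp_hasDerivAt 0 ((hH 0).mul (hS 0))).const_mul (-2)
  have hH0 : H 0 = C - ∑ i, A i := by simp [H, hB0]
  have hS0 : S 0 = ∑ i, ⁅X i, A i⁆ := by simp [S, hB0]
  obtain ⟨r1, r2⟩ := nonneg_of_isMin_of_hasDerivAt hg hg' (by
    intro t
    rw [hH0]
    have := hmin (fun i => NormedSpace.exp (t • X i)) (fun i => (exp_smul_skew _ (hX i) t).2)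
    simp only [(exp_smul_skew _ (hX _) t).1] at this
    exact this)
  simp only [hH0, hS0, hB0] at r1 r2
  refine ⟨by linarith, ?_⟩
  rw [Matrix.trace_add, Matrix.neg_mul, Matrix.trace_neg, Complex.add_re, Complex.neg_re] at r2
  linarith

end Variation

namespace Matrix

variable {n ι : Type*} [Fintype n] [Fintype ι]

/-- The real inner product on complex matrices. -/
def reInner (M N : Matrix n n ℂ) : ℝ := (Mᴴ * N).trace.re

theorem reInner_comm (M N : Matrix n n ℂ) : reInner M N = reInner N M := by
  rw [reInner, ← conjTranspose_conjTranspose (Mᴴ * N), trace_conjTranspose, conjTranspose_mul,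
    conjTranspose_conjTranspose]
  rfl

theorem reInner_sub_right (M N N' : Matrix n n ℂ) :
    reInner M (N - N') = reInner M N - reInner M N' := by
  simp [reInner, Matrix.mul_sub]

theorem reInner_sub_left (M N N' : Matrix n n ℂ) :
    reInner (N - N') M = reInner N M - reInner N' M := by
  simp only [reInner_comm _ M, reInner_sub_right]

theorem reInner_sum_right (M : Matrix n n ℂ) (N : ι → Matrix n n ℂ) :
    reInner M (∑ i, N i) = ∑ i, reInner M (N i) := by
  simp [reInner, Matrix.mul_sum, trace_sum]

theorem reInner_lie_left {H : Matrix n n ℂ} (hH : Hᴴ = H) (M N : Matrix n n ℂ) :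
    reInner ⁅H, M⁆ N = reInner M ⁅H, N⁆ := by
  simp only [reInner, Ring.lie_def, conjTranspose_sub, conjTranspose_mul, hH, Matrix.sub_mul,
    Matrix.mul_sub, trace_sub]
  rw [Matrix.mul_assoc, Matrix.mul_assoc, trace_mul_comm H, Matrix.mul_assoc]

theorem lie_sub_right (H M N : Matrix n n ℂ) : ⁅H, M - N⁆ = ⁅H, M⁆ - ⁅H, N⁆ := by
  simp only [Ring.lie_def, Matrix.mul_sub, Matrix.sub_mul]
  abel

theorem reInner_lie_lie {H A : Matrix n n ℂ} (hH : Hᴴ = H) (hA : Aᴴ = A) (hAH : ⁅A, H⁆ = 0)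
    (M N : Matrix n n ℂ) : reInner ⁅H, M⁆ ⁅A, N⁆ = reInner ⁅A, M⁆ ⁅H, N⁆ := by
  rw [← reInner_lie_left hA, ← reInner_lie_left hH]
  congr 1
  simp only [Ring.lie_def] at hAH ⊢
  have hAH' := sub_eq_zero.1 hAH
  simp only [Matrix.mul_sub, Matrix.sub_mul, ← Matrix.mul_assoc, hAH']
  simp only [Matrix.mul_assoc, hAH']
  abel

theorem re_trace_add_conjTranspose_mul {M N : Matrix n n ℂ} (h : M * N = 0) (h' : N * M = 0) :
    ((M + Mᴴ) * (N + Nᴴ)).trace.re = 2 * reInner M N := by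
  have e : Mᴴ * Nᴴ = 0 := by rw [← conjTranspose_mul, h', conjTranspose_zero]
  have e2 : (M * Nᴴ).trace.re = reInner M N := by
    rw [trace_mul_comm, reInner_comm]; rfl
  rw [Matrix.add_mul, Matrix.mul_add, Matrix.mul_add, h, e, zero_add, add_zero, trace_add,
    Complex.add_re, e2, reInner]
  ring

theorem lie_conjTranspose {H : Matrix n n ℂ} (hH : Hᴴ = H) (M : Matrix n n ℂ) :
    ⁅H, Mᴴ⁆ = -⁅H, M⁆ᴴ := by
  simp only [Ring.lie_def, conjTranspose_sub, conjTranspose_mul, hH]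
  abel

theorem lie_skew_part {H : Matrix n n ℂ} (hH : Hᴴ = H) (M : Matrix n n ℂ) :
    ⁅H, M - Mᴴ⁆ = ⁅H, M⁆ + ⁅H, M⁆ᴴ := by
  rw [lie_sub_right, lie_conjTranspose hH, sub_neg_eq_add]

theorem trace_mul_lie (H X B : Matrix n n ℂ) : (H * ⁅X, B⁆).trace = (⁅H, X⁆ * B).trace := by
  simp only [Ring.lie_def, Matrix.sub_mul, Matrix.mul_sub, trace_sub]
  rw [← Matrix.mul_assoc, ← Matrix.mul_assoc, trace_mul_comm (H * B), Matrix.mul_assoc,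
    Matrix.mul_assoc]

/-- Matrices sending the kernel of the projection `P` into its range, and killing the range. -/
def IsCorner (P M : Matrix n n ℂ) : Prop := P * M = M ∧ M * P = 0

namespace IsCorner

variable {P M N H : Matrix n n ℂ}

theorem mul_eq_zero (hM : IsCorner P M) (hN : IsCorner P N) : M * N = 0 := by
  rw [← hN.1, ← Matrix.mul_assoc, hM.2, Matrix.zero_mul]

theorem sub (hM : IsCorner P M) (hN : IsCorner P N) : IsCorner P (M - N) := by
  constructor
  · rw [Matrix.mul_sub, hM.1, hN.1]
  · rw [Matrix.sub_mul, hM.2, hN.2, sub_zero]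

theorem sum {M : ι → Matrix n n ℂ} (hM : ∀ i, IsCorner P (M i)) : IsCorner P (∑ i, M i) := by
  constructor
  · rw [Matrix.mul_sum]; exact Finset.sum_congr rfl fun i _ => (hM i).1
  · rw [Matrix.sum_mul]; exact Finset.sum_eq_zero fun i _ => (hM i).2

theorem lie (hM : IsCorner P M) (hH : P * H = H * P) : IsCorner P ⁅H, M⁆ := by
  rw [Ring.lie_def]
  constructor
  · rw [Matrix.mul_sub, ← Matrix.mul_assoc, ← Matrix.mul_assoc, hH, hM.1, Matrix.mul_assoc, hM.1]
  · rw [Matrix.sub_mul, Matrix.mul_assoc, Matrix.mul_assoc, ← hH, hM.2, ← Matrix.mul_assoc, hM.2]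
    simp

end IsCorner

theorem second_variation_eq (H C P η : Matrix n n ℂ) (A ζ : ι → Matrix n n ℂ)
    (hH : Hᴴ = H) (hA : ∀ i, (A i)ᴴ = A i) (hC : C = H + ∑ i, A i)
    (hAH : ∀ i, ⁅A i, H⁆ = 0) (hPH : P * H = H * P) (hPA : ∀ i, P * A i = A i * P)
    (hη : IsCorner P η) (hζ : ∀ i, IsCorner P (ζ i)) (heq : ∑ i, ⁅A i, ζ i⁆ = ⁅C, η⁆)
    (X : ι → Matrix n n ℂ) (hX : ∀ i, X i = (ζ i - η) - (ζ i - η)ᴴ) :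
    ((∑ i, ⁅X i, A i⁆) * ∑ i, ⁅X i, A i⁆).trace.re -
      (H * ∑ i, ⁅X i, ⁅X i, A i⁆⁆).trace.re =
    2 * ∑ i, reInner ⁅H, ζ i⁆ ⁅A i, ζ i⁆ - 2 * reInner ⁅H, η⁆ ⁅C, η⁆ := by
  have hξ : ∀ i, IsCorner P (ζ i - η) := fun i => (hζ i).sub hη
  have hXA : ∀ i, ⁅X i, A i⁆ = -(⁅A i, ζ i - η⁆ + ⁅A i, ζ i - η⁆ᴴ) := by
    intro i
    rw [← lie_skew_part (hA i), ← hX, Ring.lie_def, Ring.lie_def, neg_sub]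
  have hsum : ∑ i, ⁅A i, ζ i - η⁆ = ⁅H, η⁆ := by
    simp only [lie_sub_right, Finset.sum_sub_distrib, heq, hC]
    simp only [Ring.lie_def, Finset.sum_sub_distrib, Matrix.add_mul, Matrix.mul_add,
      Matrix.sum_mul, Matrix.mul_sum]
    abel
  have hS : ∑ i, ⁅X i, A i⁆ = -(⁅H, η⁆ + ⁅H, η⁆ᴴ) := by
    simp only [hXA, Finset.sum_neg_distrib, Finset.sum_add_distrib, hsum, ← conjTranspose_sum]
  have h1 : ((∑ i, ⁅X i, A i⁆) * ∑ i, ⁅X i, A i⁆).trace.re = 2 * reInner ⁅H, η⁆ ⁅H, η⁆ := by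
    have := (hη.lie hPH).mul_eq_zero (hη.lie hPH)
    rw [hS, neg_mul_neg, re_trace_add_conjTranspose_mul this this]
  have h2 : ∀ i, (H * ⁅X i, ⁅X i, A i⁆⁆).trace.re = -(2 * reInner ⁅H, ζ i - η⁆ ⁅A i, ζ i - η⁆) := by
    intro i
    rw [trace_mul_lie, hXA, Matrix.mul_neg, trace_neg, Complex.neg_re, hX i, lie_skew_part hH,
      re_trace_add_conjTranspose_mul]
    · exact ((hξ i).lie hPH).mul_eq_zero ((hξ i).lie (hPA i))
    · exact ((hξ i).lie (hPA i)).mul_eq_zero ((hξ i).lie hPH)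
  have h3 : ∀ i, reInner ⁅H, ζ i - η⁆ ⁅A i, ζ i - η⁆ = reInner ⁅H, ζ i⁆ ⁅A i, ζ i⁆
      - reInner ⁅H, η⁆ ⁅A i, ζ i⁆ - reInner ⁅H, η⁆ ⁅A i, ζ i - η⁆ := by
    intro i
    rw [lie_sub_right, reInner_sub_left, lie_sub_right (A i), reInner_sub_right ⁅H, ζ i⁆,
      reInner_lie_lie hH (hA i) (hAH i) (ζ i) η, reInner_comm ⁅A i, ζ i⁆ ⁅H, η⁆]
  rw [h1, Matrix.mul_sum, trace_sum, Complex.re_sum]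
  simp only [h2, h3, Finset.sum_neg_distrib, ← Finset.mul_sum, Finset.sum_sub_distrib,
    ← reInner_sum_right, heq, hsum]
  ring

end Matrix

namespace Matrix

variable {n : Type*} [Fintype n] [DecidableEq n]

theorem lie_diagonal_apply (a : n → ℂ) (M : Matrix n n ℂ) (k l : n) :
    ⁅diagonal a, M⁆ k l = (a k - a l) * M k l := by
  rw [Ring.lie_def, sub_apply, diagonal_mul, mul_diagonal]
  ring

theorem reInner_lie_diagonal (a b : n → ℝ) (M : Matrix n n ℂ) :
    reInner ⁅diagonal (fun k => (a k : ℂ)), M⁆ ⁅diagonal (fun k => (b k : ℂ)), M⁆ =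
      ∑ k, ∑ l, (a k - a l) * (b k - b l) * ‖M k l‖ ^ 2 := by
  rw [reInner, trace, Complex.re_sum, Finset.sum_comm]
  refine Finset.sum_congr rfl fun l _ => ?_
  rw [diag_apply, mul_apply, Complex.re_sum]
  refine Finset.sum_congr rfl fun k _ => ?_
  rw [conjTranspose_apply, lie_diagonal_apply, lie_diagonal_apply, ← Complex.ofReal_sub,
    ← Complex.ofReal_sub, star_mul', ← starRingEnd_apply, ← starRingEnd_apply, Complex.conj_ofReal,
    mul_mul_mul_comm, Complex.conj_mul', ← Complex.ofReal_mul, ← Complex.ofReal_pow,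
    ← Complex.ofReal_mul, Complex.ofReal_re]

theorem reInner_conj {W : Matrix n n ℂ} (hW : Wᴴ * W = 1) (M N : Matrix n n ℂ) :
    reInner (W * M * Wᴴ) (W * N * Wᴴ) = reInner M N := by
  rw [reInner, reInner, conjTranspose_mul, conjTranspose_mul, conjTranspose_conjTranspose]
  have : W * (Mᴴ * Wᴴ) * (W * N * Wᴴ) = W * (Mᴴ * (Wᴴ * W) * N * Wᴴ) := by
    simp only [Matrix.mul_assoc]
  rw [this, hW, Matrix.mul_one, trace_mul_comm, Matrix.mul_assoc, hW, Matrix.mul_one]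

theorem lie_conj {W : Matrix n n ℂ} (hW : Wᴴ * W = 1) (M N : Matrix n n ℂ) :
    ⁅W * M * Wᴴ, W * N * Wᴴ⁆ = W * ⁅M, N⁆ * Wᴴ := by
  have e : ∀ M N, W * M * Wᴴ * (W * N * Wᴴ) = W * (M * N) * Wᴴ := by
    intro M N
    have : W * M * Wᴴ * (W * N * Wᴴ) = W * (M * (Wᴴ * W) * N) * Wᴴ := by
      simp only [Matrix.mul_assoc]
    rw [this, hW, Matrix.mul_one]
  rw [Ring.lie_def, Ring.lie_def, e, e, Matrix.mul_sub, Matrix.sub_mul]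

theorem isCorner_diagonal_iff (K : Finset n) (M : Matrix n n ℂ) :
    IsCorner (diagonal fun k => if k ∈ K then 1 else 0) M ↔
      ∀ k l, M k l ≠ 0 → k ∈ K ∧ l ∉ K := by
  constructor
  · rintro ⟨h1, h2⟩ k l hkl
    have h1 := congrFun (congrFun h1 k) l
    have h2 := congrFun (congrFun h2 k) l
    rw [diagonal_mul] at h1
    rw [mul_diagonal] at h2
    refine ⟨by by_contra h; simp [h] at h1; exact hkl h1.symm, fun h => hkl (by simpa [h] using h2)⟩
  · intro h
    constructor <;> ext k l
    · rw [diagonal_mul]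
      by_cases hkl : M k l = 0
      · simp [hkl]
      · simp [h k l hkl]
    · rw [mul_diagonal]
      by_cases hkl : M k l = 0
      · simp [hkl]
      · simp [h k l hkl]

theorem diagonal_mul_eq_mul_diagonal_comp {W : Matrix n n ℂ} {a b : n → ℝ}
    (h : diagonal (fun k => (a k : ℂ)) * W = W * diagonal (fun k => (b k : ℂ))) (φ : ℝ → ℂ) :
    diagonal (fun k => φ (a k)) * W = W * diagonal (fun k => φ (b k)) := by
  ext k l
  have := congrFun (congrFun h k) l
  rw [diagonal_mul, mul_diagonal] at this ⊢
  by_cases hW : W k l = 0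
  · simp [hW]
  · have : (a k : ℂ) = b l := mul_right_cancel₀ hW (this.trans (mul_comm _ _))
    rw [Complex.ofReal_injective this, mul_comm]

end Matrix

open Matrix in
theorem card_inversions_add_le_of_isMin {n ι : Type*} [Fintype n] [DecidableEq n] [Fintype ι]
    (c h : n → ℝ) (α κ : ι → n → ℝ) (W : ι → Matrix n n ℂ) (hW : ∀ i, (W i)ᴴ * W i = 1)
    (hC : diagonal (fun k => (c k : ℂ)) = diagonal (fun k => (h k : ℂ)) +
      ∑ i, W i * diagonal (fun k => (α i k : ℂ)) * (W i)ᴴ)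
    (hHW : ∀ i, diagonal (fun k => (h k : ℂ)) * W i = W i * diagonal (fun k => (κ i k : ℂ)))
    (hmin : ∀ V : ι → Matrix n n ℂ, (∀ i, (V i)ᴴ * V i = 1) →
      (diagonal (fun k => (h k : ℂ)) * diagonal (fun k => (h k : ℂ))).trace.re ≤
      ((diagonal (fun k => (c k : ℂ)) - ∑ i, V i * diagonal (fun k => (α i k : ℂ)) * (V i)ᴴ) *
        (diagonal (fun k => (c k : ℂ)) -
          ∑ i, V i * diagonal (fun k => (α i k : ℂ)) * (V i)ᴴ)).trace.re)
    (K : Finset n) (hK : ∀ k, k ∈ K ↔ 0 < h k) (I : ι → Finset n)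
    (hI : ∀ i k, k ∈ I i ↔ 0 < κ i k) :
    ∑ i, (Finset.univ.filter fun t : n × n => t.1 ∈ I i ∧ t.2 ∉ I i ∧ α i t.1 < α i t.2).card +
      (Finset.univ.filter fun t : n × n => t.1 ∈ K ∧ t.2 ∉ K ∧ c t.2 < c t.1).card ≤
      K.card * Kᶜ.card := by
  by_contra! hlt
  obtain ⟨S, hS⟩ : ∃ S : ι → Finset (n × n), ∀ i, S i = Finset.univ.filter fun t : n × n =>
    t.1 ∈ I i ∧ t.2 ∉ I i ∧ α i t.1 < α i t.2 := ⟨_, fun _ => rfl⟩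
  have hSm : ∀ {i k l}, (k, l) ∈ S i → k ∈ I i ∧ l ∉ I i ∧ α i k < α i l := by
    intro i k l hkl; simpa [hS] using hkl
  obtain ⟨E, hE⟩ : ∃ E : Finset (n × n), E = Finset.univ.filter fun t : n × n =>
    t.1 ∈ K ∧ t.2 ∉ K ∧ ¬ c t.2 < c t.1 := ⟨_, rfl⟩
  have hEcard : (Finset.univ.filter fun t : n × n => t.1 ∈ K ∧ t.2 ∉ K ∧ c t.2 < c t.1).card +
      E.card = K.card * Kᶜ.card := by
    rw [← Finset.card_product, hE, ← Finset.card_union_of_disjoint]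
    · congr 1; ext t
      simp only [Finset.mem_filter, Finset.mem_union, Finset.mem_product, Finset.mem_compl,
        Finset.mem_univ, true_and]
      tauto
    · rw [Finset.disjoint_filter]; tauto
  simp only [← hS] at hlt
  let Z : ((Σ i, S i) → ℂ) → ι → Matrix n n ℂ := fun z i => ofSupport (S i) fun t => z ⟨i, t⟩
  obtain ⟨A, hA⟩ : ∃ A : ι → Matrix n n ℂ, ∀ i, A i =
    W i * diagonal (fun k => (α i k : ℂ)) * (W i)ᴴ := ⟨_, fun _ => rfl⟩
  let ζ : ((Σ i, S i) → ℂ) → ι → Matrix n n ℂ := fun z i => W i * Z z i * (W i)ᴴ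
  let Λ : ((Σ i, S i) → ℂ) →ₗ[ℂ] (E → ℂ) :=
    { toFun := fun z e => (∑ i, ⁅A i, ζ z i⁆) e.1.1 e.1.2
      map_add' := by
        intro z z'
        have : ∀ i, ⁅A i, ζ (z + z') i⁆ = ⁅A i, ζ z i⁆ + ⁅A i, ζ z' i⁆ := by
          intro i
          have : Z (z + z') i = Z z i + Z z' i := ofSupport_add _ _
          simp only [ζ, this, Ring.lie_def, Matrix.mul_add, Matrix.add_mul]
          abel
        funext e
        simp only [this, Finset.sum_add_distrib, Matrix.add_apply, Pi.add_apply]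
      map_smul' := by
        intro t z
        have : ∀ i, ⁅A i, ζ (t • z) i⁆ = t • ⁅A i, ζ z i⁆ := by
          intro i
          have : Z (t • z) i = t • Z z i := ofSupport_smul _ _
          simp only [ζ, this, Ring.lie_def, Matrix.mul_smul, Matrix.smul_mul, smul_sub]
        funext e
        simp only [this, ← Finset.smul_sum, Matrix.smul_apply, Pi.smul_apply, RingHom.id_apply] }
  have hker : LinearMap.ker Λ ≠ ⊥ := by
    apply LinearMap.ker_ne_bot_of_finrank_lt
    rw [Module.finrank_pi, Module.finrank_pi, Fintype.card_sigma, Fintype.card_coe]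
    simp only [Fintype.card_coe]
    omega
  obtain ⟨z, hz, hz0⟩ := (Submodule.ne_bot_iff _).1 hker
  have hΛ : ∀ e ∈ E, (∑ i, ⁅A i, ζ z i⁆) e.1 e.2 = 0 :=
    fun e he => congrFun (LinearMap.mem_ker.1 hz) ⟨e, he⟩
  obtain ⟨P, hP⟩ : ∃ P : Matrix n n ℂ, P = diagonal fun k => if k ∈ K then 1 else 0 := ⟨_, rfl⟩
  have hPH : Pᴴ = P := by
    rw [hP, diagonal_conjTranspose]; congr 1; funext k; simp [apply_ite star]
  have hPW : ∀ i, P * W i = W i * diagonal fun k => if k ∈ I i then 1 else 0 := by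
    intro i
    have := diagonal_mul_eq_mul_diagonal_comp (hHW i) (fun x => if 0 < x then 1 else 0)
    simpa only [← hK, ← hI, ← hP] using this
  have hPW' : ∀ i, (W i)ᴴ * P = (diagonal fun k => if k ∈ I i then 1 else 0) * (W i)ᴴ := by
    intro i
    have := congrArg conjTranspose (hPW i)
    rw [conjTranspose_mul, conjTranspose_mul, hPH, diagonal_conjTranspose] at this
    rw [this]
    congr 2
    funext k; simp [apply_ite star]
  have hζ : ∀ i, IsCorner P (ζ z i) := by
    intro i
    have hZ : IsCorner (diagonal fun k => if k ∈ I i then 1 else 0) (Z z i) := by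
      rw [isCorner_diagonal_iff]
      intro k l hkl
      have := hSm (ofSupport_ne_zero hkl)
      exact ⟨this.1, this.2.1⟩
    constructor
    · simp only [ζ]
      rw [← Matrix.mul_assoc, ← Matrix.mul_assoc, hPW, Matrix.mul_assoc (W i), hZ.1]
    · simp only [ζ]
      rw [Matrix.mul_assoc, hPW', ← Matrix.mul_assoc, Matrix.mul_assoc (W i), hZ.2]
      simp
  have hPA : ∀ i, P * A i = A i * P := by
    intro i
    rw [hA, ← Matrix.mul_assoc, ← Matrix.mul_assoc, hPW, Matrix.mul_assoc _ _ P, hPW',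
      ← Matrix.mul_assoc, Matrix.mul_assoc (W i), Matrix.mul_assoc (W i),
      (commute_diagonal _ _).eq]
    simp only [Matrix.mul_assoc]
  have hAH : ∀ i, ⁅A i, diagonal (fun k => (h k : ℂ))⁆ = 0 := by
    intro i
    have h1 : (W i)ᴴ * diagonal (fun k => (h k : ℂ)) =
        diagonal (fun k => (κ i k : ℂ)) * (W i)ᴴ := by
      have := congrArg conjTranspose (hHW i)
      simpa [conjTranspose_mul, diagonal_conjTranspose, Pi.star_def] using this
    rw [Ring.lie_def, sub_eq_zero, hA, Matrix.mul_assoc, h1, ← Matrix.mul_assoc,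
      ← Matrix.mul_assoc, ← Matrix.mul_assoc, hHW, Matrix.mul_assoc (W i), Matrix.mul_assoc (W i),
      (commute_diagonal _ _).eq]
    simp only [Matrix.mul_assoc]
  obtain ⟨R, hR⟩ : ∃ R, R = ∑ i, ⁅A i, ζ z i⁆ := ⟨_, rfl⟩
  have hRc : IsCorner P R := hR ▸ IsCorner.sum fun i => (hζ i).lie (hPA i)
  rw [hP, isCorner_diagonal_iff] at hRc
  let η : Matrix n n ℂ := fun k l => R k l / (c k - c l)
  have hRc' : ∀ k l, R k l ≠ 0 → c l < c k := by
    intro k l hkl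
    by_contra hcon
    refine hkl ?_
    rw [hR]
    refine hΛ (k, l) ?_
    rw [hE]
    simp only [Finset.mem_filter, Finset.mem_univ, true_and]
    exact ⟨(hRc k l hkl).1, (hRc k l hkl).2, hcon⟩
  have hηR : ∀ k l, η k l ≠ 0 → R k l ≠ 0 := by
    intro k l hkl h0
    exact hkl (by simp [η, h0])
  have hη : IsCorner P η := by
    rw [hP, isCorner_diagonal_iff]
    exact fun k l hkl => hRc k l (hηR k l hkl)
  have heq : ∑ i, ⁅A i, ζ z i⁆ = ⁅diagonal (fun k => (c k : ℂ)), η⁆ := by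
    rw [← hR]
    ext k l
    rw [lie_diagonal_apply]
    by_cases h0 : R k l = 0
    · simp [η, h0]
    · have : (c k : ℂ) - c l ≠ 0 := by
        rw [← Complex.ofReal_sub, Complex.ofReal_ne_zero]
        exact (sub_pos.2 (hRc' k l h0)).ne'
      simp only [η]
      field_simp
  have hC' : diagonal (fun k => (c k : ℂ)) = diagonal (fun k => (h k : ℂ)) + ∑ i, A i := by
    simp only [hA]; exact hC
  have hCA : diagonal (fun k => (c k : ℂ)) - ∑ i, A i = diagonal (fun k => (h k : ℂ)) := by
    rw [hC', add_sub_cancel_right]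
  have hvar := (variation_of_isMin (diagonal fun k => (c k : ℂ)) A
    (fun i => (ζ z i - η) - (ζ z i - η)ᴴ) (fun i => by simp) (by
      intro V hV
      have := hmin (fun i => V i * W i) (fun i => by
        rw [conjTranspose_mul, Matrix.mul_assoc, ← Matrix.mul_assoc (V i)ᴴ, hV, Matrix.one_mul, hW])
      have e : ∀ i, V i * A i * (V i)ᴴ =
          V i * W i * diagonal (fun k => (α i k : ℂ)) * (V i * W i)ᴴ := by
        intro i
        rw [hA, conjTranspose_mul]
        simp only [Matrix.mul_assoc]
      rw [hCA]
      simp only [e]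
      exact this)).2
  rw [hCA, second_variation_eq _ (diagonal fun k => (c k : ℂ)) P η A (ζ z)
    (by simp [diagonal_conjTranspose, Pi.star_def]) (by
      intro i
      rw [hA]
      simp [conjTranspose_mul, diagonal_conjTranspose, Pi.star_def, Matrix.mul_assoc]) hC' hAH
    (by rw [hP, (commute_diagonal _ _).eq]) hPA hη hζ heq _ (fun i => rfl)] at hvar
  have t1 : ∀ i, reInner ⁅diagonal (fun k => (h k : ℂ)), ζ z i⁆ ⁅A i, ζ z i⁆ =
      ∑ k, ∑ l, (κ i k - κ i l) * (α i k - α i l) * ‖Z z i k l‖ ^ 2 := by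
    intro i
    have : diagonal (fun k => (h k : ℂ)) =
        W i * diagonal (fun k => (κ i k : ℂ)) * (W i)ᴴ := by
      rw [← hHW, Matrix.mul_assoc, mul_eq_one_comm.1 (hW i), Matrix.mul_one]
    rw [this, hA, lie_conj (hW i), lie_conj (hW i), reInner_conj (hW i), reInner_lie_diagonal]
  have t2 : 0 ≤ reInner ⁅diagonal (fun k => (h k : ℂ)), η⁆ ⁅diagonal (fun k => (c k : ℂ)), η⁆ := by
    rw [reInner_lie_diagonal]
    refine Finset.sum_nonneg fun k _ => Finset.sum_nonneg fun l _ => ?_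
    by_cases h0 : η k l = 0
    · simp [h0]
    · have h1 := hRc k l (hηR k l h0)
      have h2 := hRc' k l (hηR k l h0)
      rw [hK, hK] at h1
      refine mul_nonneg (mul_nonneg ?_ ?_) (sq_nonneg _) <;> linarith
  have t3 : ∀ i k l, (κ i k - κ i l) * (α i k - α i l) * ‖Z z i k l‖ ^ 2 ≤ 0 ∧
      (Z z i k l ≠ 0 → (κ i k - κ i l) * (α i k - α i l) * ‖Z z i k l‖ ^ 2 < 0) := by
    intro i k l
    have key : Z z i k l ≠ 0 → (κ i k - κ i l) * (α i k - α i l) * ‖Z z i k l‖ ^ 2 < 0 := by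
      intro h0
      have h1 := hSm (ofSupport_ne_zero h0)
      rw [hI, hI] at h1
      refine mul_neg_of_neg_of_pos (mul_neg_of_pos_of_neg ?_ ?_) (by positivity) <;> linarith
    refine ⟨?_, key⟩
    by_cases h0 : Z z i k l = 0
    · simp [h0]
    · exact (key h0).le
  obtain ⟨i, k, l, hikl⟩ : ∃ i k l, Z z i k l ≠ 0 := by
    by_contra! hcon
    refine hz0 (funext fun t => ?_)
    have : ofSupport (S t.1) (fun s => z ⟨t.1, s⟩) = 0 := by
      ext k l; exact hcon t.1 k l
    exact congrFun (eq_zero_of_ofSupport_eq_zero this) t.2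
  have t4 : ∑ i, reInner ⁅diagonal (fun k => (h k : ℂ)), ζ z i⁆ ⁅A i, ζ z i⁆ < 0 := by
    simp only [t1]
    refine Finset.sum_neg' (fun i _ => Finset.sum_nonpos fun k _ => Finset.sum_nonpos fun l _ =>
      (t3 i k l).1) ⟨i, Finset.mem_univ _, ?_⟩
    refine Finset.sum_neg' (fun k _ => Finset.sum_nonpos fun l _ => (t3 i k l).1)
      ⟨k, Finset.mem_univ _, ?_⟩
    exact Finset.sum_neg' (fun l _ => (t3 i k l).1) ⟨l, Finset.mem_univ _, (t3 i k l).2 hikl⟩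
  linarith

namespace Matrix

/-- A Hermitian matrix which is diagonal has real diagonal. -/
theorem eq_diagonal_ofReal {n : Type*} [Fintype n] [DecidableEq n] {M : Matrix n n ℂ}
    (hM : Mᴴ = M) (hd : ∀ k l, k ≠ l → M k l = 0) :
    M = diagonal fun k => ((M k k).re : ℂ) := by
  ext k l
  by_cases hkl : k = l
  · subst hkl
    rw [diagonal_apply_eq]
    have : star (M k k) = M k k := by
      conv_rhs => rw [← hM]
      rfl
    exact (Complex.conj_eq_iff_re.1 this).symm
  · rw [hd k l hkl, diagonal_apply_ne _ hkl]

/-- Two commuting Hermitian matrices are simultaneously unitarily diagonalizable. -/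
theorem exists_joint_diagonalization {p : ℕ} {C H : Matrix (Fin p) (Fin p) ℂ}
    (hC : Cᴴ = C) (hH : Hᴴ = H) (hCH : C * H = H * C) :
    ∃ (B : Matrix (Fin p) (Fin p) ℂ) (c h : Fin p → ℝ), Bᴴ * B = 1 ∧
      C * B = B * diagonal (fun k => (c k : ℂ)) ∧ H * B = B * diagonal (fun k => (h k : ℂ)) := by
  classical
  have sC : (toEuclideanLin C).IsSymmetric := isSymmetric_toEuclideanLin_iff.2 hC
  have sH : (toEuclideanLin H).IsSymmetric := isSymmetric_toEuclideanLin_iff.2 hH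
  have hcomm : Commute (toEuclideanLin C) (toEuclideanLin H) := by
    refine LinearMap.ext fun v => ?_
    simp [Module.End.mul_apply, toEuclideanLin, toLpLin_apply, mulVec_mulVec, hCH]
  have hInternal := sC.directSum_isInternal_of_commute sH hcomm
  have hort := sC.orthogonalFamily_eigenspace_inf_eigenspace sH
  have hInternal' := DirectSum.isInternal_ne_bot_iff.2 hInternal
  have : Finite {i : ℂ × ℂ // (Module.End.eigenspace (toEuclideanLin C) i.2 ⊓
      Module.End.eigenspace (toEuclideanLin H) i.1) ≠ ⊥} :=
    WellFoundedGT.finite_ne_bot_of_iSupIndep hInternal.submodule_iSupIndep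
  have := Fintype.ofFinite {i : ℂ × ℂ // (Module.End.eigenspace (toEuclideanLin C) i.2 ⊓
      Module.End.eigenspace (toEuclideanLin H) i.1) ≠ ⊥}
  have hort' := hort.comp (Subtype.val_injective (p := fun i : ℂ × ℂ =>
    (Module.End.eigenspace (toEuclideanLin C) i.2 ⊓
      Module.End.eigenspace (toEuclideanLin H) i.1) ≠ ⊥))
  have hn : Module.finrank ℂ (EuclideanSpace ℂ (Fin p)) = p := by simp
  let b := hInternal'.subordinateOrthonormalBasis hn hort'
  let e := fun k => (hInternal'.subordinateOrthonormalBasisIndex hn k hort').1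
  have hb : ∀ k, b k ∈ Module.End.eigenspace (toEuclideanLin C) (e k).2 ⊓
      Module.End.eigenspace (toEuclideanLin H) (e k).1 := fun k =>
    hInternal'.subordinateOrthonormalBasis_subordinate hn k hort'
  let B : Matrix (Fin p) (Fin p) ℂ := of fun l k => b k l
  have hB : Bᴴ * B = 1 := by
    ext k l
    have := orthonormal_iff_ite.1 b.orthonormal k l
    rw [PiLp.inner_apply] at this
    rw [mul_apply, one_apply, ← this]
    refine Finset.sum_congr rfl fun x _ => ?_
    simp [B, mul_comm]
  have key : ∀ (M : Matrix (Fin p) (Fin p) ℂ) (μ : Fin p → ℂ), Mᴴ = M →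
      (∀ k, b k ∈ Module.End.eigenspace (toEuclideanLin M) (μ k)) →
      M * B = B * diagonal (fun k => ((μ k).re : ℂ)) := by
    intro M μ hM hμ
    have h1 : M * B = B * diagonal μ := by
      ext l k
      have := congrArg (fun v : EuclideanSpace ℂ (Fin p) => v l)
        (Module.End.mem_eigenspace_iff.1 (hμ k))
      rw [mul_diagonal]
      simpa [toEuclideanLin, mul_apply, mulVec, dotProduct, B, mul_comm] using this
    have h2 : Bᴴ * M * B = diagonal μ := by
      rw [Matrix.mul_assoc, h1, ← Matrix.mul_assoc, hB, Matrix.one_mul]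
    have h3 := eq_diagonal_ofReal (M := diagonal μ)
      (by rw [← h2]; simp [conjTranspose_mul, hM, Matrix.mul_assoc])
      (fun k l hkl => diagonal_apply_ne _ hkl)
    rw [h1, h3]
    simp
  exact ⟨B, _, _, hB, key C _ hC fun k => (hb k).1, key H _ hH fun k => (hb k).2⟩

/-- A continuous function attains its minimum on tuples of unitary matrices. -/
theorem exists_isMin_unitary {n ι : Type*} [Fintype n] [DecidableEq n] [Fintype ι]
    (f : (ι → Matrix n n ℂ) → ℝ) (hf : Continuous f) :
    ∃ U : ι → Matrix n n ℂ, (∀ i, (U i)ᴴ * U i = 1) ∧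
      ∀ V : ι → Matrix n n ℂ, (∀ i, (V i)ᴴ * V i = 1) → f U ≤ f V := by
  have hcl : IsClosed {U : ι → Matrix n n ℂ | ∀ i, (U i)ᴴ * U i = 1} := by
    simp only [Set.ofPred_forall]
    exact isClosed_iInter fun i => isClosed_eq (by fun_prop) continuous_const
  have hsub : {U : ι → Matrix n n ℂ | ∀ i, (U i)ᴴ * U i = 1} ⊆
      Set.univ.pi fun _ => Set.univ.pi fun _ => Set.univ.pi fun _ => Metric.closedBall (0 : ℂ) 1 := by
    intro U hU i _ k _ l _
    rw [mem_closedBall_zero_iff]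
    exact norm_apply_le_one_of_orthonormal (U i) (hU i) k l
  have hcpt : IsCompact {U : ι → Matrix n n ℂ | ∀ i, (U i)ᴴ * U i = 1} := by
    refine IsCompact.of_isClosed_subset ?_ hcl hsub
    exact isCompact_univ_pi fun _ => isCompact_univ_pi fun _ => isCompact_univ_pi fun _ =>
      isCompact_closedBall _ _
  obtain ⟨U, hU, hmin⟩ := hcpt.exists_isMinOn ⟨fun _ => 1, fun i => by simp⟩ hf.continuousOn
  exact ⟨U, hU, fun V hV => hmin hV⟩

end Matrix

namespace Matrix

open ComplexOrder in
theorem eq_zero_of_re_trace_mul_self {n : Type*} [Fintype n] {X : Matrix n n ℂ} (hX : Xᴴ = -X)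
    (h : (X * X).trace.re = 0) : X = 0 := by
  have h0 : 0 ≤ (Xᴴ * X).trace := (posSemidef_conjTranspose_mul_self X).trace_nonneg
  rw [← trace_conjTranspose_mul_self_eq_zero_iff]
  refine Complex.ext ?_ (Complex.le_def.1 h0).2.symm
  rw [hX, neg_mul, trace_neg, Complex.neg_re, h, neg_zero, Complex.zero_re]

/-- At a minimizer of the Frobenius distance from `C` to sums of matrices with prescribed simple
spectra, all matrices involved are simultaneously diagonalizable with the residual. -/
theorem exists_minimizing_frames {p : ℕ} {ι : Type*} [Fintype ι] {C : Matrix (Fin p) (Fin p) ℂ}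
    (hC : Cᴴ = C) (α : ι → Fin p → ℝ) (hα : ∀ i, Function.Injective (α i)) :
    ∃ (B : Matrix (Fin p) (Fin p) ℂ) (c h : Fin p → ℝ) (W : ι → Matrix (Fin p) (Fin p) ℂ)
      (κ : ι → Fin p → ℝ), Bᴴ * B = 1 ∧ C = B * diagonal (fun k => (c k : ℂ)) * Bᴴ ∧
      (∀ i, (W i)ᴴ * W i = 1) ∧
      diagonal (fun k => (c k : ℂ)) = diagonal (fun k => (h k : ℂ)) +
        ∑ i, W i * diagonal (fun k => (α i k : ℂ)) * (W i)ᴴ ∧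
      (∀ i, diagonal (fun k => (h k : ℂ)) * W i = W i * diagonal (fun k => (κ i k : ℂ))) ∧
      ∀ V : ι → Matrix (Fin p) (Fin p) ℂ, (∀ i, (V i)ᴴ * V i = 1) →
        (diagonal (fun k => (h k : ℂ)) * diagonal (fun k => (h k : ℂ))).trace.re ≤
        ((diagonal (fun k => (c k : ℂ)) - ∑ i, V i * diagonal (fun k => (α i k : ℂ)) * (V i)ᴴ) *
          (diagonal (fun k => (c k : ℂ)) -
            ∑ i, V i * diagonal (fun k => (α i k : ℂ)) * (V i)ᴴ)).trace.re := by
  classical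
  obtain ⟨U, hU, hmin⟩ := exists_isMin_unitary
    (fun V : ι → Matrix (Fin p) (Fin p) ℂ =>
      ((C - ∑ i, V i * diagonal (fun k => (α i k : ℂ)) * (V i)ᴴ) *
        (C - ∑ i, V i * diagonal (fun k => (α i k : ℂ)) * (V i)ᴴ)).trace.re) (by fun_prop)
  have hU' : ∀ i, U i * (U i)ᴴ = 1 := fun i => mul_eq_one_comm.1 (hU i)
  obtain ⟨A, hA⟩ : ∃ A : ι → Matrix (Fin p) (Fin p) ℂ,
      ∀ i, A i = U i * diagonal (fun k => (α i k : ℂ)) * (U i)ᴴ := ⟨_, fun i => rfl⟩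
  have hAH : ∀ i, (A i)ᴴ = A i := by
    intro i
    rw [hA]
    simp [conjTranspose_mul, diagonal_conjTranspose, Pi.star_def, Matrix.mul_assoc]
  obtain ⟨H, hH⟩ : ∃ H, H = C - ∑ i, A i := ⟨_, rfl⟩
  have hHH : Hᴴ = H := by
    rw [hH, conjTranspose_sub, conjTranspose_sum, hC]
    simp only [hAH]
  have hcomm : ∀ i, A i * H = H * A i := by
    intro i
    rw [← sub_eq_zero]
    have hskew : (A i * H - H * A i)ᴴ = -(A i * H - H * A i) := by
      rw [conjTranspose_sub, conjTranspose_mul, conjTranspose_mul, hHH, hAH, neg_sub]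
    refine eq_zero_of_re_trace_mul_self hskew ?_
    have := (variation_of_isMin C A (fun j => if j = i then A i * H - H * A i else 0)
      (by intro j; split_ifs <;> simp [hskew, -neg_sub]) (by
        intro V hV
        have := hmin (fun i => V i * U i) (fun i => by
          rw [conjTranspose_mul, Matrix.mul_assoc, ← Matrix.mul_assoc (V i)ᴴ, hV, Matrix.one_mul,
            hU])
        have e : ∀ i, V i * A i * (V i)ᴴ =
            V i * U i * diagonal (fun k => (α i k : ℂ)) * (V i * U i)ᴴ := by
          intro i
          rw [hA, conjTranspose_mul]
          simp only [Matrix.mul_assoc]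
        simp only [e]
        simpa only [hA] using this)).1
    have e : ∑ j, ⁅(if j = i then A i * H - H * A i else 0), A j⁆ = ⁅A i * H - H * A i, A i⁆ := by
      rw [Finset.sum_eq_single i (fun j _ hj => by rw [if_neg hj, Ring.lie_def]; simp) (by simp),
        if_pos rfl]
    rw [e, ← hH, trace_mul_lie, Ring.lie_def, Matrix.sub_mul, trace_sub, Matrix.mul_assoc,
      trace_mul_comm H, ← trace_sub, Matrix.mul_assoc, Matrix.mul_assoc, ← Matrix.mul_sub] at this
    exact this
  have hCA : C = H + ∑ i, A i := by rw [hH, sub_add_cancel]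
  have hCH : C * H = H * C := by
    rw [hCA, Matrix.add_mul, Matrix.mul_add, Matrix.sum_mul, Matrix.mul_sum]
    simp only [hcomm]
  obtain ⟨B, c, h, hB, hCB, hHB⟩ := exists_joint_diagonalization hC hHH hCH
  have hB' : B * Bᴴ = 1 := mul_eq_one_comm.1 hB
  have hκ : ∀ i, ∃ κ : Fin p → ℝ, H * U i = U i * diagonal (fun k => (κ k : ℂ)) := by
    intro i
    obtain ⟨N, hNd⟩ : ∃ N, N = (U i)ᴴ * H * U i := ⟨_, rfl⟩
    have hN : Nᴴ = N := by simp [hNd, conjTranspose_mul, hHH, Matrix.mul_assoc]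
    have hHU : H * U i = U i * N := by
      rw [hNd]
      rw [← Matrix.mul_assoc, ← Matrix.mul_assoc, hU', Matrix.one_mul]
    have hNc : N * diagonal (fun k => (α i k : ℂ)) = diagonal (fun k => (α i k : ℂ)) * N := by
      have h1 : A i * U i = U i * diagonal (fun k => (α i k : ℂ)) := by
        rw [hA, Matrix.mul_assoc, hU, Matrix.mul_one]
      have h2 : U i * (N * diagonal (fun k => (α i k : ℂ))) =
          U i * (diagonal (fun k => (α i k : ℂ)) * N) := by
        rw [← Matrix.mul_assoc, ← Matrix.mul_assoc, ← hHU, ← h1, Matrix.mul_assoc, ← h1,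
          Matrix.mul_assoc, ← hHU, ← Matrix.mul_assoc, ← Matrix.mul_assoc, hcomm]
      have := congrArg (fun M => (U i)ᴴ * M) h2
      simpa only [← Matrix.mul_assoc, hU, Matrix.one_mul] using this
    refine ⟨fun k => (N k k).re, ?_⟩
    rw [hHU, eq_diagonal_ofReal hN]
    · simp
    · intro k l hkl
      have := congrFun (congrFun hNc k) l
      rw [mul_diagonal, diagonal_mul, mul_comm, ← sub_eq_zero, ← sub_mul, mul_eq_zero, sub_eq_zero,
        Complex.ofReal_inj] at this
      exact this.resolve_left fun e => hkl (hα i e).symm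
  choose κ hκ using hκ
  have hconj : ∀ V : ι → Matrix (Fin p) (Fin p) ℂ,
      Bᴴ * (∑ i, V i * diagonal (fun k => (α i k : ℂ)) * (V i)ᴴ) * B =
      ∑ i, (Bᴴ * V i) * diagonal (fun k => (α i k : ℂ)) * (Bᴴ * V i)ᴴ := by
    intro V
    rw [Matrix.mul_sum, Matrix.sum_mul]
    refine Finset.sum_congr rfl fun i _ => ?_
    rw [conjTranspose_mul, conjTranspose_conjTranspose]
    simp only [Matrix.mul_assoc]
  have hc : Bᴴ * C * B = diagonal (fun k => (c k : ℂ)) := by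
    rw [Matrix.mul_assoc, hCB, ← Matrix.mul_assoc, hB, Matrix.one_mul]
  have hh : Bᴴ * H * B = diagonal (fun k => (h k : ℂ)) := by
    rw [Matrix.mul_assoc, hHB, ← Matrix.mul_assoc, hB, Matrix.one_mul]
  have htr : ∀ M : Matrix (Fin p) (Fin p) ℂ, ((Bᴴ * M * B) * (Bᴴ * M * B)).trace =
      (M * M).trace := by
    intro M
    have : (Bᴴ * M * B) * (Bᴴ * M * B) = Bᴴ * (M * (B * Bᴴ) * M * B) := by
      simp only [Matrix.mul_assoc]
    rw [this, hB', Matrix.mul_one, trace_mul_comm, Matrix.mul_assoc, hB', Matrix.mul_one]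
  refine ⟨B, c, h, fun i => Bᴴ * U i, κ, hB, ?_, ?_, ?_, ?_, ?_⟩
  · rw [← hCB, Matrix.mul_assoc, hB', Matrix.mul_one]
  · intro i
    rw [conjTranspose_mul, conjTranspose_conjTranspose, Matrix.mul_assoc, ← Matrix.mul_assoc B,
      hB', Matrix.one_mul, hU]
  · rw [← hc, ← hh, ← hconj, ← Matrix.add_mul, ← Matrix.mul_add, hCA]
    simp only [hA]
  · intro i
    rw [← hh, Matrix.mul_assoc, ← Matrix.mul_assoc B, hB', Matrix.one_mul, Matrix.mul_assoc, hκ,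
      Matrix.mul_assoc]
  · intro V hV
    have h1 := hmin (fun i => B * V i) (fun i => by
      rw [conjTranspose_mul, Matrix.mul_assoc, ← Matrix.mul_assoc Bᴴ, hB, Matrix.one_mul, hV])
    simp only [← hA, ← hH] at h1
    rw [← htr H, hh, ← htr (C - _), Matrix.mul_sub, Matrix.sub_mul, hconj, hc] at h1
    simpa only [← Matrix.mul_assoc, hB, Matrix.one_mul] using h1

theorem card_eq_of_intertwine {n : Type*} [Fintype n] [DecidableEq n] {W : Matrix n n ℂ}
    (hW : Wᴴ * W = 1) {h κ : n → ℝ}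
    (hHW : diagonal (fun k => (h k : ℂ)) * W = W * diagonal (fun k => (κ k : ℂ)))
    {K I : Finset n} (hK : ∀ k, k ∈ K ↔ 0 < h k) (hI : ∀ k, k ∈ I ↔ 0 < κ k) :
    I.card = K.card := by
  have h1 := diagonal_mul_eq_mul_diagonal_comp hHW (fun x => if 0 < x then 1 else 0)
  simp only [← hK, ← hI] at h1
  have h2 := congrArg (fun M => (M * Wᴴ).trace) h1
  rw [Matrix.mul_assoc, mul_eq_one_comm.1 hW, Matrix.mul_one, trace_mul_comm, ← Matrix.mul_assoc,
    hW, Matrix.one_mul, trace_diagonal, trace_diagonal] at h2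
  simpa using h2.symm

end Matrix

namespace Matrix

theorem norm_conj_diagonal_apply_le {n : Type*} [Fintype n] [DecidableEq n] {W : Matrix n n ℂ}
    (hW : Wᴴ * W = 1) (a : n → ℝ) (k l : n) :
    ‖(W * diagonal (fun x => (a x : ℂ)) * Wᴴ) k l‖ ≤ ∑ x, |a x| := by
  rw [mul_apply]
  refine (norm_sum_le _ _).trans (Finset.sum_le_sum fun x _ => ?_)
  rw [mul_diagonal, norm_mul, norm_mul, conjTranspose_apply, norm_star, Complex.norm_real,
    Real.norm_eq_abs]
  have h1 := norm_apply_le_one_of_orthonormal W hW k x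
  have h2 := norm_apply_le_one_of_orthonormal W hW l x
  calc ‖W k x‖ * |a x| * ‖W l x‖ ≤ 1 * |a x| * 1 := by gcongr
    _ = |a x| := by ring

theorem norm_conj_apply_le {n : Type*} [Fintype n] [DecidableEq n] {W : Matrix n n ℂ}
    (hW : Wᴴ * W = 1) (D : Matrix n n ℂ) {δ : ℝ} (hD : ∀ a b, ‖D a b‖ ≤ δ) (k l : n) :
    ‖(Wᴴ * D * W) k l‖ ≤ Fintype.card n * (Fintype.card n * δ) := by
  rw [mul_apply, ← nsmul_eq_mul, ← nsmul_eq_mul, ← Finset.card_univ]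
  refine norm_sum_le_of_le _ (fun b _ => ?_) |>.trans (Finset.sum_const _).le
  rw [mul_apply, norm_mul]
  have hn : ‖∑ a, Wᴴ k a * D a b‖ ≤ (Finset.univ : Finset n).card • δ := by
    refine norm_sum_le_of_le _ (fun a _ => ?_) |>.trans (Finset.sum_const _).le
    rw [norm_mul, conjTranspose_apply, norm_star]
    exact (mul_le_of_le_one_left (norm_nonneg _)
      (norm_apply_le_one_of_orthonormal W hW a k)).trans (hD a b)
  exact (mul_le_of_le_one_right (norm_nonneg _)
    (norm_apply_le_one_of_orthonormal W hW b l)).trans hn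

/-- There is a unitary matrix all of whose entries have the same modulus. -/
theorem exists_unitary_norm_eq {m : ℕ} (hm : 0 < m) :
    ∃ F : Matrix (Fin m) (Fin m) ℂ, Fᴴ * F = 1 ∧ ∀ j k, F j k * star (F j k) = 1 / m := by
  have hm' : (m : ℂ) ≠ 0 := by exact_mod_cast hm.ne'
  have hζ := Complex.isPrimitiveRoot_exp m hm.ne'
  obtain ⟨ζ, hζ⟩ : ∃ ζ : ℂ, IsPrimitiveRoot ζ m := ⟨_, hζ⟩
  have hn : ‖ζ‖ = 1 := hζ.norm'_eq_one hm.ne'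
  have hz : ζ ≠ 0 := by
    rintro rfl
    simp at hn
  have hstar : star ζ = ζ⁻¹ := (Complex.inv_eq_conj hn).symm
  have hs : ((√(m : ℝ) : ℝ) : ℂ) * ((√(m : ℝ) : ℝ) : ℂ) = m := by
    rw [← Complex.ofReal_mul, Real.mul_self_sqrt (by positivity), Complex.ofReal_natCast]
  have hs0 : ((√(m : ℝ) : ℝ) : ℂ) ≠ 0 := fun h => hm' (by rw [← hs, h, mul_zero])
  refine ⟨of fun j k => ζ ^ ((j : ℕ) * k) / (√(m : ℝ) : ℝ), ?_, fun j k => ?_⟩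
  · ext i k
    rw [mul_apply, one_apply]
    have e : ∀ j : Fin m, (of fun j k : Fin m => ζ ^ ((j : ℕ) * k) / (√(m : ℝ) : ℝ))ᴴ i j *
        (of fun j k : Fin m => ζ ^ ((j : ℕ) * k) / (√(m : ℝ) : ℝ)) j k =
        (ζ ^ (k : ℕ) * (ζ ^ (i : ℕ))⁻¹) ^ (j : ℕ) / m := by
      intro j
      have : star (((√(m : ℝ) : ℝ) : ℂ)) = ((√(m : ℝ) : ℝ) : ℂ) := Complex.conj_ofReal _
      rw [conjTranspose_apply, of_apply, of_apply, star_div₀, star_pow, hstar, this,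
        div_mul_div_comm, hs, mul_pow, ← pow_mul, inv_pow, inv_pow, ← pow_mul, mul_comm,
        mul_comm (j : ℕ) k, mul_comm (j : ℕ) i]
    rw [Finset.sum_congr rfl fun j _ => e j, ← Finset.sum_div,
      Fin.sum_univ_eq_sum_range (fun j => (ζ ^ (k : ℕ) * (ζ ^ (i : ℕ))⁻¹) ^ j)]
    split_ifs with h
    · subst h
      rw [mul_inv_cancel₀ (pow_ne_zero _ hz)]
      simp [hm']
    · have hw : ζ ^ (k : ℕ) * (ζ ^ (i : ℕ))⁻¹ ≠ 1 := by
        intro hw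
        rw [mul_inv_eq_one₀ (pow_ne_zero _ hz)] at hw
        exact h (Fin.ext (hζ.pow_inj i.2 k.2 hw.symm))
      rw [geom_sum_eq hw, mul_pow, inv_pow, ← pow_mul, ← pow_mul, mul_comm (k : ℕ),
        mul_comm (i : ℕ), pow_mul, pow_mul, hζ.pow_eq_one]
      simp
  · have h1 : (ζ ^ ((j : ℕ) * k)) * star (ζ ^ ((j : ℕ) * k)) = 1 := by
      rw [star_pow, hstar, inv_pow, mul_inv_cancel₀ (pow_ne_zero _ hz)]
    have : star (((√(m : ℝ) : ℝ) : ℂ)) = ((√(m : ℝ) : ℝ) : ℂ) := Complex.conj_ofReal _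
    rw [of_apply, star_div₀, this, div_mul_div_comm, hs, h1]

end Matrix

theorem card_filter_mem_add {X : Type*} [Fintype X] [DecidableEq X] (N : Finset X)
    (P Q : X → X → Prop) [DecidableRel P] [DecidableRel Q]
    (hPQ : ∀ x ∉ N, ∀ y ∈ N, (P x y ↔ ¬ Q y x)) :
    (Finset.univ.filter fun t : X × X => t.1 ∉ N ∧ t.2 ∈ N ∧ P t.1 t.2).card +
      (Finset.univ.filter fun t : X × X => t.1 ∈ N ∧ t.2 ∉ N ∧ Q t.1 t.2).card =
      N.card * Nᶜ.card := by
  rw [← Finset.card_product, ← Finset.card_filter_add_card_filter_not (s := N ×ˢ Nᶜ)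
    (fun t => Q t.1 t.2), add_comm]
  congr 1
  · congr 1
    ext t
    simp [and_assoc]
  · refine Finset.card_bij (fun t _ => t.swap) ?_ ?_ ?_
    · intro t ht
      simp only [Finset.mem_filter, Finset.mem_univ, true_and] at ht
      simp [ht.1, ht.2.1, (hPQ _ ht.1 _ ht.2.1).1 ht.2.2]
    · intro a _ b _ h
      exact Prod.swap_injective h
    · intro t ht
      simp only [Finset.mem_filter, Finset.mem_product, Finset.mem_compl] at ht
      refine ⟨t.swap, ?_, Prod.swap_swap t⟩
      simp [ht.1.1, ht.1.2, (hPQ _ ht.1.2 _ ht.1.1).2 ht.2]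

namespace Matrix

variable {m p : ℕ}

/-- The unitary matrix with blocks `F j i • W i`. -/
def blockFrame (F : Matrix (Fin m) (Fin m) ℂ) (W : Fin m → Matrix (Fin p) (Fin p) ℂ) :
    Matrix (Fin m × Fin p) (Fin p × Fin m) ℂ :=
  of fun y x => F y.1 x.2 * W x.2 y.2 x.1

theorem blockFrame_conjTranspose_mul {F : Matrix (Fin m) (Fin m) ℂ} (hF : Fᴴ * F = 1)
    {W : Fin m → Matrix (Fin p) (Fin p) ℂ} (hW : ∀ i, (W i)ᴴ * W i = 1) :
    (blockFrame F W)ᴴ * blockFrame F W = 1 := by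
  ext x x'
  have h1 := congrFun (congrFun hF x.2) x'.2
  rw [mul_apply, one_apply] at h1 ⊢
  have e : ∀ y : Fin m × Fin p, (blockFrame F W)ᴴ x y * blockFrame F W y x' =
      Fᴴ x.2 y.1 * F y.1 x'.2 * ((W x.2)ᴴ x.1 y.2 * W x'.2 y.2 x'.1) := by
    intro y
    simp only [blockFrame, conjTranspose_apply, of_apply, star_mul']
    ring
  rw [Finset.sum_congr rfl fun y _ => e y, Fintype.sum_prod_type]
  simp only
  rw [← Finset.sum_mul_sum, h1]
  by_cases h : x.2 = x'.2
  · have h2 := congrFun (congrFun (hW x.2) x.1) x'.1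
    rw [mul_apply, one_apply] at h2
    rw [if_pos h, one_mul, ← h, h2]
    simp only [Prod.ext_iff, h, and_true]
  · rw [if_neg h, zero_mul, if_neg fun hx => h (congrArg Prod.snd hx)]

theorem blockFrame_conj_apply {F : Matrix (Fin m) (Fin m) ℂ}
    (hF : ∀ j k, F j k * star (F j k) = 1 / m) (W : Fin m → Matrix (Fin p) (Fin p) ℂ)
    (γ : Fin p × Fin m → ℝ) (j : Fin m) (l l' : Fin p) :
    (blockFrame F W * diagonal (fun x => (γ x : ℂ)) * (blockFrame F W)ᴴ) (j, l) (j, l') =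
      (∑ i, W i * diagonal (fun k => (γ (k, i) : ℂ)) * (W i)ᴴ) l l' / m := by
  rw [mul_apply, Matrix.sum_apply, Fintype.sum_prod_type, Finset.sum_comm, Finset.sum_div]
  refine Finset.sum_congr rfl fun i _ => ?_
  rw [mul_apply, Finset.sum_div]
  refine Finset.sum_congr rfl fun k _ => ?_
  rw [mul_diagonal, mul_diagonal, conjTranspose_apply, conjTranspose_apply]
  simp only [blockFrame, of_apply, star_mul']
  rw [div_eq_mul_one_div, ← hF j i]
  ring

theorem card_mul_compl_le_of_inversions (γ : Fin p × Fin m → ℝ)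
    (hγ : ∀ x y, finProdFinEquiv x < finProdFinEquiv y → γ y < γ x) (c : Fin p → ℝ)
    (K : Finset (Fin p)) (I : Fin m → Finset (Fin p)) (hI : ∀ i, (I i).card = K.card)
    (hle : ∑ i, (Finset.univ.filter fun t : Fin p × Fin p =>
        t.1 ∈ I i ∧ t.2 ∉ I i ∧ γ (t.1, i) < γ (t.2, i)).card +
      (Finset.univ.filter fun t : Fin p × Fin p => t.1 ∈ K ∧ t.2 ∉ K ∧ c t.2 < c t.1).card ≤
      K.card * Kᶜ.card)
    (N : Finset (Fin p × Fin m)) (hN : ∀ x, x ∈ N ↔ x.1 ∈ I x.2)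
    (L : Finset (Fin m × Fin p)) (hL : ∀ y, y ∈ L ↔ y.2 ∈ K) (c' : Fin m × Fin p → ℝ)
    (hc' : ∀ j k l, c' (j, k) ≤ c' (j, l) ↔ c k ≤ c l) :
    N.card = L.card ∧ N.card * Lᶜ.card ≤
      (Finset.univ.filter fun t : (Fin p × Fin m) × (Fin p × Fin m) =>
        t.1 ∉ N ∧ t.2 ∈ N ∧ γ t.1 < γ t.2).card +
      (Finset.univ.filter fun t : (Fin m × Fin p) × (Fin m × Fin p) =>
        t.1 ∉ L ∧ t.2 ∈ L ∧ t.1.1 = t.2.1 ∧ c' t.2 ≤ c' t.1).card := by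
  have hlt : ∀ x y, γ x < γ y ↔ finProdFinEquiv y < finProdFinEquiv x := by
    intro x y
    refine ⟨fun h => ?_, hγ y x⟩
    by_contra! hcon
    rcases hcon.lt_or_eq with h' | h'
    · exact lt_asymm h (hγ _ _ h')
    · rw [finProdFinEquiv.injective h'] at h
      exact lt_irrefl _ h
  have hLc : L.card = m * K.card := by
    have : L = Finset.univ ×ˢ K := by ext y; simp [hL]
    rw [this, Finset.card_product, Finset.card_univ, Fintype.card_fin]
  have hLc' : Lᶜ.card = m * Kᶜ.card := by
    have : Lᶜ = Finset.univ ×ˢ Kᶜ := by ext y; simp [hL]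
    rw [this, Finset.card_product, Finset.card_univ, Fintype.card_fin]
  have hNc : N.card = m * K.card := by
    have : N = Finset.univ.filter fun x : Fin p × Fin m => x.1 ∈ I x.2 := by ext y; simp [hN]
    rw [this, Finset.card_filter, Fintype.sum_prod_type, Finset.sum_comm]
    have e : ∀ i, (∑ k, if k ∈ I i then 1 else 0) = K.card := fun i => by
      rw [← hI i]; simp
    simp only [e]
    simp
  have hNc' : Nᶜ.card = Lᶜ.card := by
    rw [Finset.card_compl, Finset.card_compl, hLc, hNc]
    simp [mul_comm]
  have c1 := card_filter_mem_add N (fun x y => γ x < γ y)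
    (fun x y => finProdFinEquiv y < finProdFinEquiv x) (by
      intro x hx y hy
      rw [hlt, not_lt, le_iff_lt_or_eq]
      refine ⟨Or.inl, fun h => h.resolve_right fun h' => ?_⟩
      rw [finProdFinEquiv.injective h'] at hy
      exact hx hy)
  have c2 := card_inversions_interleave I hI
  have c3 : (Finset.univ.filter fun t : (Fin m × Fin p) × (Fin m × Fin p) =>
      t.1 ∉ L ∧ t.2 ∈ L ∧ t.1.1 = t.2.1 ∧ c' t.2 ≤ c' t.1).card =
      m * (Finset.univ.filter fun t : Fin p × Fin p => t.1 ∉ K ∧ t.2 ∈ K ∧ c t.2 ≤ c t.1).card := by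
    conv_rhs => rw [← Fintype.card_fin m, ← Finset.card_univ, ← Finset.card_product]
    symm
    refine Finset.card_bij (fun s _ => ((s.1, s.2.1), (s.1, s.2.2))) ?_ ?_ ?_
    · intro s hs
      simpa [hL, hc'] using hs
    · rintro ⟨a, b, d⟩ _ ⟨a', b', d'⟩ _ h
      simp only [Prod.mk.injEq] at h ⊢
      exact ⟨h.1.1, h.1.2, h.2.2⟩
    · rintro ⟨⟨a, b⟩, ⟨a', d⟩⟩ ht
      simp only [Finset.mem_filter, Finset.mem_univ, true_and, hL] at ht
      obtain ⟨h1, h2, rfl, h4⟩ := ht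
      exact ⟨(a, b, d), by simpa [h1, h2] using (hc' _ _ _).1 h4, rfl⟩
  have c4 := card_filter_mem_add K (fun x y => c y ≤ c x) (fun x y => c y < c x)
    (fun x _ y _ => not_lt.symm)
  have c5 : ∀ i, (Finset.univ.filter fun t : Fin p × Fin p =>
      t.1 ∈ I i ∧ t.2 ∉ I i ∧ γ (t.1, i) < γ (t.2, i)) =
      (Finset.univ.filter fun t : Fin p × Fin p => t.1 ∈ I i ∧ t.2 ∉ I i ∧ t.2 < t.1) := by
    intro i
    have hm : 0 < m := i.pos
    ext t
    simp only [hlt, Fin.lt_def, finProdFinEquiv_apply_val, Finset.mem_filter, Finset.mem_univ,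
      true_and, add_lt_add_iff_left, Nat.mul_lt_mul_left hm]
  simp only [c5] at hle
  simp only [hN] at c1 ⊢
  rw [c2] at c1
  rw [c3, hLc']
  refine ⟨hNc.trans hLc.symm, ?_⟩
  rw [hNc', hNc, hLc'] at c1
  have := Nat.mul_le_mul_left m hle
  rw [hNc]
  nlinarith

end Matrix

namespace Matrix

open scoped Kronecker in
/-- If the diagonal blocks of a unitary conjugate of `diagonal γ` are all close to `C / m`, then
`C` is close to a sum of matrices with interlaced spectra. -/
theorem exists_norm_sub_sum_conj_le {m p : ℕ} (hm : 0 < m) {F : Matrix (Fin m) (Fin m) ℂ}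
    (hF : Fᴴ * F = 1) (hF' : ∀ j k, F j k * star (F j k) = 1 / m)
    {C : Matrix (Fin p) (Fin p) ℂ} (hC : Cᴴ = C) (γ : Fin p × Fin m → ℝ)
    (hγ : ∀ x y, finProdFinEquiv x < finProdFinEquiv y → γ y < γ x)
    (htr : C.trace = ∑ x, (γ x : ℂ)) {G : Matrix (Fin m × Fin p) (Fin p × Fin m) ℂ}
    (hG : Gᴴ * G = 1) {δ : ℝ} (hδ0 : 0 ≤ δ)
    (hδ : ∀ j a b, ‖(G * diagonal (fun x => (γ x : ℂ)) * Gᴴ) (j, a) (j, b) - C a b / m‖ ≤ δ) :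
    ∃ U : Fin m → Matrix (Fin p) (Fin p) ℂ, (∀ i, (U i)ᴴ * U i = 1) ∧ ∀ a b,
      ‖(C - ∑ i, U i * diagonal (fun k => (γ (k, i) : ℂ)) * (U i)ᴴ) a b‖ ≤
        2 * (m * p * (m * (p * (p * (p * (p * δ)))))) := by
  have hm0 : (0 : ℝ) < m := by exact_mod_cast hm
  have hinj : ∀ i : Fin m, Function.Injective fun k => γ (k, i) := by
    intro i k l hkl
    by_contra hne
    have hne' : finProdFinEquiv (k, i) ≠ finProdFinEquiv (l, i) :=
      fun h => hne (congrArg Prod.fst (finProdFinEquiv.injective h))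
    rcases lt_or_gt_of_ne hne' with h | h
    · exact (hγ _ _ h).ne' hkl
    · exact (hγ _ _ h).ne hkl
  obtain ⟨B, c, h, W, κ, hB, hCB, hW, hch, hHW, hmin⟩ :=
    exists_minimizing_frames hC (fun i k => γ (k, i)) hinj
  have hB' : B * Bᴴ = 1 := mul_eq_one_comm.1 hB
  let K := Finset.univ.filter fun k => 0 < h k
  let I := fun i => Finset.univ.filter fun k => 0 < κ i k
  have hK : ∀ k, k ∈ K ↔ 0 < h k := by simp [K]
  have hI : ∀ i k, k ∈ I i ↔ 0 < κ i k := by simp [I]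
  have hle := card_inversions_add_le_of_isMin c h (fun i k => γ (k, i)) κ W hW hch hHW hmin K hK
    I hI
  let N := Finset.univ.filter fun x : Fin p × Fin m => x.1 ∈ I x.2
  let L := Finset.univ.filter fun y : Fin m × Fin p => y.2 ∈ K
  have hN : ∀ x, x ∈ N ↔ x.1 ∈ I x.2 := by simp [N]
  have hL : ∀ y, y ∈ L ↔ y.2 ∈ K := by simp [L]
  obtain ⟨hcard, hcount⟩ := card_mul_compl_le_of_inversions γ hγ c K I
    (fun i => card_eq_of_intertwine (hW i) (hHW i) hK (hI i)) hle N hN L hL (fun y => c y.2 / m)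
    (fun j k l => div_le_div_iff_of_pos_right hm0)
  have hBB : ((1 : Matrix (Fin m) (Fin m) ℂ) ⊗ₖ B) * ((1 : Matrix (Fin m) (Fin m) ℂ) ⊗ₖ B)ᴴ = 1 := by
    rw [conjTranspose_kronecker, conjTranspose_one, ← mul_kronecker_mul, hB', Matrix.one_mul,
      one_kronecker_one]
  have hQ₀ := blockFrame_conjTranspose_mul hF hW
  have key := sum_le_of_critical_frame Prod.fst γ (fun y => c y.2 / m) (fun y => h y.2 / m)
    (blockFrame F W) (((1 : Matrix (Fin m) (Fin m) ℂ) ⊗ₖ B)ᴴ * G) hQ₀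
    ((mul_eq_one_comm_of_card_eq _ _ _ (by simp [mul_comm])).1 hQ₀)
    (by
      rw [conjTranspose_mul, conjTranspose_conjTranspose, Matrix.mul_assoc,
        ← Matrix.mul_assoc (_ ⊗ₖ B), hBB, Matrix.one_mul, hG]) N L hcard
    (by
      intro y hy x hx
      have h1 := congrFun (congrFun (hHW x.2) y.2) x.1
      rw [mul_diagonal, diagonal_mul, mul_comm, ← sub_eq_zero, ← mul_sub, mul_eq_zero, sub_eq_zero,
        Complex.ofReal_inj] at h1
      rw [hL, hK] at hy
      rw [hN, hI] at hx
      rw [blockFrame, of_apply, h1.resolve_right fun h2 => hy (h2 ▸ hx), mul_zero])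
    (by
      intro y hy y' hy'
      rw [hL, hK] at hy hy'
      exact div_lt_div_of_pos_right (by linarith) hm0)
    (by
      rintro ⟨j, k⟩ ⟨_, l⟩ rfl
      rw [blockFrame_conj_apply hF', ← sub_eq_of_eq_add' hch, sub_apply]
      simp only [diagonal_apply, Prod.mk.injEq, true_and]
      split_ifs
      · push_cast
        ring
      · simp)
    hcount
  have hterm : ∀ y y' : Fin m × Fin p, y.1 = y'.1 →
      ‖(((1 : Matrix (Fin m) (Fin m) ℂ) ⊗ₖ B)ᴴ * G * diagonal (fun x => (γ x : ℂ)) *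
        (((1 : Matrix (Fin m) (Fin m) ℂ) ⊗ₖ B)ᴴ * G)ᴴ -
        diagonal (fun y : Fin m × Fin p => ((c y.2 / m : ℝ) : ℂ))) y y'‖ ≤ p * (p * δ) := by
    rintro ⟨j, k⟩ ⟨_, l⟩ rfl
    obtain ⟨M, hM⟩ : ∃ M, M = G * diagonal (fun x => (γ x : ℂ)) * Gᴴ := ⟨_, rfl⟩
    have e : ((1 : Matrix (Fin m) (Fin m) ℂ) ⊗ₖ B)ᴴ * G * diagonal (fun x => (γ x : ℂ)) *
        (((1 : Matrix (Fin m) (Fin m) ℂ) ⊗ₖ B)ᴴ * G)ᴴ =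
        ((1 : Matrix (Fin m) (Fin m) ℂ) ⊗ₖ B)ᴴ * M * ((1 : Matrix (Fin m) (Fin m) ℂ) ⊗ₖ B) := by
      rw [hM, conjTranspose_mul, conjTranspose_conjTranspose]
      simp only [Matrix.mul_assoc]
    have e1 : (((1 : Matrix (Fin m) (Fin m) ℂ) ⊗ₖ B)ᴴ * M *
        ((1 : Matrix (Fin m) (Fin m) ℂ) ⊗ₖ B)) (j, k) (j, l) =
        (Bᴴ * (of fun a b => M (j, a) (j, b)) * B) k l := by
      simp [mul_apply, Fintype.sum_prod_type, conjTranspose_apply, kroneckerMap_apply, one_apply,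
        ite_mul, mul_ite, apply_ite star]
    have e2 : (diagonal (fun y : Fin m × Fin p => ((c y.2 / m : ℝ) : ℂ))) (j, k) (j, l) =
        (Bᴴ * (of fun a b => C a b / m) * B) k l := by
      have h1 : (of fun a b => C a b / m) = (m : ℂ)⁻¹ • C := by
        ext a b
        simp [div_eq_inv_mul]
      have h2 : Bᴴ * C * B = diagonal (fun k => (c k : ℂ)) := by
        rw [hCB, ← Matrix.mul_assoc, ← Matrix.mul_assoc, hB, Matrix.one_mul, Matrix.mul_assoc, hB,
          Matrix.mul_one]
      rw [h1, Matrix.mul_smul, Matrix.smul_mul, h2]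
      simp only [diagonal_apply, Prod.mk.injEq, true_and, smul_apply, smul_eq_mul]
      split_ifs
      · push_cast
        ring
      · simp
    have := norm_conj_apply_le hB ((of fun a b => M (j, a) (j, b)) - of fun a b => C a b / m)
      (δ := δ) (by
        intro a b
        rw [hM]
        exact hδ j a b) k l
    rw [e, sub_apply, e1, e2, ← sub_apply, ← Matrix.sub_mul, ← Matrix.mul_sub]
    simpa using this
  have hLsum : ∑ y ∈ L, h y.2 / m = ∑ k ∈ K, h k := by
    have : L = Finset.univ ×ˢ K := by ext y; simp [hL]
    rw [this, Finset.sum_product]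
    simp only [← Finset.sum_div]
    rw [Finset.sum_const, Finset.card_univ, Fintype.card_fin, nsmul_eq_mul]
    field_simp
  have hKsum : ∑ k ∈ K, h k ≤ m * p * (m * (p * (p * (p * (p * δ))))) := by
    rw [← hLsum]
    refine key.trans ?_
    have h1 : (L.card : ℝ) ≤ m * p := by
      have := Finset.card_le_univ L
      rw [Fintype.card_prod, Fintype.card_fin, Fintype.card_fin] at this
      exact_mod_cast this
    have h2 : (∑ y : Fin m × Fin p, ∑ y' : Fin m × Fin p, if y.1 = y'.1 then
        ‖(((1 : Matrix (Fin m) (Fin m) ℂ) ⊗ₖ B)ᴴ * G * diagonal (fun x => (γ x : ℂ)) *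
        (((1 : Matrix (Fin m) (Fin m) ℂ) ⊗ₖ B)ᴴ * G)ᴴ -
        diagonal (fun y : Fin m × Fin p => ((c y.2 / m : ℝ) : ℂ))) y y'‖ else 0) ≤
        m * (p * (p * (p * (p * δ)))) := by
      obtain ⟨φ, hφ⟩ : ∃ φ : Fin m → Fin m → ℝ, ∀ i j, φ i j = if i = j then p * (p * δ) else 0 :=
        ⟨_, fun _ _ => rfl⟩
      calc _ ≤ ∑ y : Fin m × Fin p, ∑ y' : Fin m × Fin p, φ y.1 y'.1 := by
            refine Finset.sum_le_sum fun y _ => Finset.sum_le_sum fun y' _ => ?_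
            rw [hφ]
            split_ifs with h
            · exact hterm y y' h
            · exact le_rfl
        _ = m * (p * (p * (p * (p * δ)))) := by
            simp only [Fintype.sum_prod_type, Finset.sum_const]
            simp [hφ]
    exact mul_le_mul h1 h2 (Finset.sum_nonneg fun y _ => Finset.sum_nonneg fun y' _ => by
      split_ifs <;> positivity) (by positivity)
  have hsum : ∑ k, h k = 0 := by
    have h1 := congrArg trace hch
    have h2 : C.trace = (diagonal (fun k => (c k : ℂ))).trace := by
      rw [hCB, trace_mul_comm, ← Matrix.mul_assoc, hB, Matrix.one_mul]
    have h3 : (∑ i, W i * diagonal (fun k => (γ (k, i) : ℂ)) * (W i)ᴴ).trace =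
        ∑ x, (γ x : ℂ) := by
      rw [trace_sum, Fintype.sum_prod_type, Finset.sum_comm]
      refine Finset.sum_congr rfl fun i _ => ?_
      rw [trace_mul_comm, ← Matrix.mul_assoc, hW, Matrix.one_mul, trace_diagonal]
    rw [trace_add, ← h2, htr, h3, right_eq_add, trace_diagonal] at h1
    exact_mod_cast h1
  have habs : ∑ k, |h k| = 2 * ∑ k ∈ K, h k := by
    have : ∀ k, |h k| = 2 * (if 0 < h k then h k else 0) - h k := by
      intro k
      split_ifs with hk
      · rw [abs_of_pos hk]; ring
      · rw [abs_of_nonpos (not_lt.1 hk)]; ring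
    rw [Finset.sum_congr rfl fun k _ => this k, Finset.sum_sub_distrib, hsum, sub_zero,
      ← Finset.mul_sum, ← Finset.sum_filter]
  refine ⟨fun i => B * W i, fun i => ?_, fun a b => ?_⟩
  · rw [conjTranspose_mul, Matrix.mul_assoc, ← Matrix.mul_assoc Bᴴ, hB, Matrix.one_mul, hW]
  · have e : C - ∑ i, B * W i * diagonal (fun k => (γ (k, i) : ℂ)) * (B * W i)ᴴ =
        B * diagonal (fun k => (h k : ℂ)) * Bᴴ := by
      have : ∑ i, B * W i * diagonal (fun k => (γ (k, i) : ℂ)) * (B * W i)ᴴ =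
          B * (∑ i, W i * diagonal (fun k => (γ (k, i) : ℂ)) * (W i)ᴴ) * Bᴴ := by
        rw [Matrix.mul_sum, Matrix.sum_mul]
        refine Finset.sum_congr rfl fun i _ => ?_
        rw [conjTranspose_mul]
        simp only [Matrix.mul_assoc]
      rw [this, hCB, ← Matrix.sub_mul, ← Matrix.mul_sub, hch, add_sub_cancel_right]
    rw [e]
    refine (norm_conj_diagonal_apply_le hB h a b).trans ?_
    rw [habs]
    linarith

end Matrix

namespace Matrix

variable {m p : ℕ}

/-- The unitary matrix `F ⊗ 1`, with rows indexed by blocks. -/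
def blockTransform (F : Matrix (Fin m) (Fin m) ℂ) : Matrix (Fin m × Fin p) (Fin p × Fin m) ℂ :=
  of fun y x => if y.2 = x.1 then F y.1 x.2 else 0

theorem blockTransform_conjTranspose_mul {F : Matrix (Fin m) (Fin m) ℂ} (hF : Fᴴ * F = 1) :
    (blockTransform (p := p) F)ᴴ * blockTransform (p := p) F = 1 := by
  have : blockTransform (p := p) F = blockFrame F fun _ => 1 := by
    ext y x
    simp [blockTransform, blockFrame, one_apply]
  rw [this]
  exact blockFrame_conjTranspose_mul hF fun _ => by simp

theorem blockTransform_conj_blockDiagonal_apply {F : Matrix (Fin m) (Fin m) ℂ}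
    (hF : ∀ j k, F j k * star (F j k) = 1 / m) (A : Fin m → Matrix (Fin p) (Fin p) ℂ) (j : Fin m)
    (a b : Fin p) : (blockTransform (p := p) F * blockDiagonal (fun i => A i) *
      (blockTransform (p := p) F)ᴴ)
      (j, a) (j, b) = (∑ i, A i) a b / m := by
  simp only [mul_apply, Fintype.sum_prod_type, blockTransform, of_apply, conjTranspose_apply,
    blockDiagonal_apply, ite_mul, zero_mul, apply_ite star, star_zero, mul_ite, mul_zero,
    Finset.sum_ite_eq, Finset.sum_ite_eq', Finset.mem_univ, if_true]
  rw [Finset.sum_comm, Matrix.sum_apply, Finset.sum_div]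
  refine Finset.sum_congr rfl fun i _ => ?_
  rw [Finset.sum_ite_eq, if_pos (Finset.mem_univ b), mul_right_comm, hF, one_div, div_eq_mul_inv,
    mul_comm]

/-- If the diagonal blocks of a unitary conjugate of `diagonal γ` all equal `C / m`, then `C` is a
sum of Hermitian matrices with spectra `γ (·, i)`. -/
theorem exists_sum_conj_eq (hm : 0 < m) (hp : 0 < p) {F : Matrix (Fin m) (Fin m) ℂ}
    (hF : Fᴴ * F = 1) (hF' : ∀ j k, F j k * star (F j k) = 1 / m)
    {C : Matrix (Fin p) (Fin p) ℂ} (hC : Cᴴ = C) (γ : Fin p × Fin m → ℝ)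
    (hγ : ∀ x y, finProdFinEquiv x < finProdFinEquiv y → γ y ≤ γ x)
    (htr : C.trace = ∑ x, (γ x : ℂ)) {G : Matrix (Fin m × Fin p) (Fin p × Fin m) ℂ}
    (hG : Gᴴ * G = 1)
    (hGC : ∀ j a b, (G * diagonal (fun x => (γ x : ℂ)) * Gᴴ) (j, a) (j, b) = C a b / m) :
    ∃ U : Fin m → Matrix (Fin p) (Fin p) ℂ, (∀ i, (U i)ᴴ * U i = 1) ∧
      ∑ i, U i * diagonal (fun k => (γ (k, i) : ℂ)) * (U i)ᴴ = C := by
  obtain ⟨U, hU, hmin⟩ := exists_isMin_unitary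
    (fun V : Fin m → Matrix (Fin p) (Fin p) ℂ => ∑ a, ∑ b,
      ‖(C - ∑ i, V i * diagonal (fun k => (γ (k, i) : ℂ)) * (V i)ᴴ) a b‖) (by fun_prop)
  have hcard : (Fintype.card (Fin p × Fin m) : ℝ) ≠ 0 := by
    rw [Fintype.card_prod, Fintype.card_fin, Fintype.card_fin]
    positivity
  obtain ⟨Δ, hΔ0, hΔ⟩ : ∃ Δ : Fin p × Fin m → ℝ, ∑ x, Δ x = 0 ∧
      ∀ x y, finProdFinEquiv x < finProdFinEquiv y → Δ y < Δ x := by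
    refine ⟨fun x => (∑ y : Fin p × Fin m, ((finProdFinEquiv y : ℕ) : ℝ)) / Fintype.card (Fin p × Fin m) -
      (finProdFinEquiv x : ℕ), ?_, fun x y h => ?_⟩
    · rw [Finset.sum_sub_distrib, Finset.sum_const, nsmul_eq_mul, Finset.card_univ,
        mul_div_cancel₀ _ hcard, sub_self]
    · exact sub_lt_sub_left (by exact_mod_cast h) _
  obtain ⟨D, hD⟩ : ∃ D, D = ∑ y, ∑ y', ‖(G * diagonal (fun x => (Δ x : ℂ)) * Gᴴ) y y'‖ := ⟨_, rfl⟩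
  have hD0 : 0 ≤ D := hD ▸ Finset.sum_nonneg fun _ _ => Finset.sum_nonneg fun _ _ => norm_nonneg _
  have hdiag : ∀ ε : ℝ, diagonal (fun x => ((γ x + ε * Δ x : ℝ) : ℂ)) =
      diagonal (fun x => (γ x : ℂ)) + (ε : ℂ) • diagonal (fun x => (Δ x : ℂ)) := by
    intro ε
    rw [← diagonal_smul, diagonal_add]
    congr 1
    funext x
    simp
  obtain ⟨c, hc⟩ : ∃ c : ℝ, c = 2 * (m * p * (m * (p * (p * (p * (p * D)))))) +
    ∑ i : Fin m, ∑ k : Fin p, |Δ (k, i)| := ⟨_, rfl⟩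
  have hbound : ∀ ε : ℝ, 0 < ε → (∑ a, ∑ b,
      ‖(C - ∑ i, U i * diagonal (fun k => (γ (k, i) : ℂ)) * (U i)ᴴ) a b‖) ≤
      ε * (p * (p * c)) := by
    intro ε hε
    obtain ⟨V, hV, hVC⟩ := exists_norm_sub_sum_conj_le hm hF hF' hC (fun x => γ x + ε * Δ x)
      (fun x y h => by nlinarith [hγ x y h, hΔ x y h, mul_lt_mul_of_pos_left (hΔ x y h) hε])
      (by
        rw [htr]
        push_cast
        rw [Finset.sum_add_distrib, ← Finset.mul_sum, ← Complex.ofReal_sum _ Δ, hΔ0]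
        simp) hG (δ := ε * D) (by positivity) (by
        intro j a b
        rw [hdiag, Matrix.mul_add, Matrix.add_mul, add_apply, hGC, add_sub_cancel_left,
          Matrix.mul_smul, Matrix.smul_mul, smul_apply, norm_smul, Complex.norm_real,
          Real.norm_eq_abs, abs_of_pos hε, hD]
        refine mul_le_mul_of_nonneg_left ?_ hε.le
        exact (Finset.single_le_sum (f := fun y' =>
            ‖(G * diagonal (fun x => (Δ x : ℂ)) * Gᴴ) (j, a) y'‖) (fun _ _ => norm_nonneg _)
            (Finset.mem_univ (j, b))).trans
          (Finset.single_le_sum (f := fun y => ∑ y',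
            ‖(G * diagonal (fun x => (Δ x : ℂ)) * Gᴴ) y y'‖)
            (fun _ _ => Finset.sum_nonneg fun _ _ => norm_nonneg _) (Finset.mem_univ (j, a))))
    refine (hmin V hV).trans ?_
    have hterm : ∀ a b, ‖(C - ∑ i, V i * diagonal (fun k => (γ (k, i) : ℂ)) * (V i)ᴴ) a b‖ ≤
        ε * c := by
      intro a b
      have e : C - ∑ i, V i * diagonal (fun k => (γ (k, i) : ℂ)) * (V i)ᴴ =
          (C - ∑ i, V i * diagonal (fun k => ((γ (k, i) + ε * Δ (k, i) : ℝ) : ℂ)) * (V i)ᴴ) +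
          (ε : ℂ) • ∑ i, V i * diagonal (fun k => (Δ (k, i) : ℂ)) * (V i)ᴴ := by
        have e1 : ∀ i, V i * diagonal (fun k => ((γ (k, i) + ε * Δ (k, i) : ℝ) : ℂ)) * (V i)ᴴ =
            V i * diagonal (fun k => (γ (k, i) : ℂ)) * (V i)ᴴ +
            (ε : ℂ) • (V i * diagonal (fun k => (Δ (k, i) : ℂ)) * (V i)ᴴ) := by
          intro i
          rw [← Matrix.smul_mul, ← Matrix.mul_smul, ← Matrix.add_mul, ← Matrix.mul_add,
            ← diagonal_smul, diagonal_add]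
          congr 3
          funext x
          simp
        simp only [e1]
        rw [Finset.sum_add_distrib, ← Finset.smul_sum]
        abel
      rw [e, add_apply, smul_apply]
      refine (norm_add_le _ _).trans ?_
      have h1 := hVC a b
      have h2 : ‖(∑ i, V i * diagonal (fun k => (Δ (k, i) : ℂ)) * (V i)ᴴ) a b‖ ≤
          ∑ i : Fin m, ∑ k : Fin p, |Δ (k, i)| := by
        rw [Matrix.sum_apply]
        exact norm_sum_le_of_le _ fun i _ => norm_conj_diagonal_apply_le (hV i) _ a b
      rw [norm_smul, Complex.norm_real, Real.norm_eq_abs, abs_of_pos hε, hc, mul_add]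
      refine add_le_add (h1.trans (le_of_eq (by ring))) (mul_le_mul_of_nonneg_left h2 hε.le)
    calc _ ≤ ∑ _a : Fin p, ∑ _b : Fin p, ε * c :=
          Finset.sum_le_sum fun a _ => Finset.sum_le_sum fun b _ => hterm a b
      _ = ε * (p * (p * c)) := by
          simp
          ring
  have hc0 : 0 ≤ p * (p * c) := by
    have : 0 ≤ c := hc ▸ by positivity
    positivity
  have hle : (∑ a, ∑ b,
      ‖(C - ∑ i, U i * diagonal (fun k => (γ (k, i) : ℂ)) * (U i)ᴴ) a b‖) ≤ 0 := by
    refine le_of_forall_pos_le_add fun η hη => ?_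
    rw [zero_add]
    refine (hbound (η / (p * (p * c) + 1)) (by positivity)).trans ?_
    rw [div_mul_eq_mul_div, div_le_iff₀ (by positivity)]
    nlinarith
  refine ⟨U, hU, (sub_eq_zero.1 ?_).symm⟩
  ext a b
  rw [zero_apply, ← norm_le_zero_iff]
  exact ((Finset.single_le_sum (f := fun b =>
      ‖(C - ∑ i, U i * diagonal (fun k => (γ (k, i) : ℂ)) * (U i)ᴴ) a b‖)
      (fun _ _ => norm_nonneg _) (Finset.mem_univ b)).trans
    (Finset.single_le_sum (f := fun a => ∑ b,
      ‖(C - ∑ i, U i * diagonal (fun k => (γ (k, i) : ℂ)) * (U i)ᴴ) a b‖)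
      (fun _ _ => Finset.sum_nonneg fun _ _ => norm_nonneg _) (Finset.mem_univ a))).trans hle

end Matrix

namespace Matrix

variable {m p : ℕ}

theorem trace_conj_of_conjTranspose_mul_eq_one {ι κ : Type*} [Fintype ι] [Fintype κ]
    [DecidableEq κ] {G : Matrix ι κ ℂ} (hG : Gᴴ * G = 1) (D : Matrix κ κ ℂ) :
    (G * D * Gᴴ).trace = D.trace := by
  rw [trace_mul_comm, ← Matrix.mul_assoc, hG, Matrix.one_mul]

/-- Reindexing of `Fin p × Fin m` between the lexicographic enumerations by the first and by the
second factor. -/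
def enumSwap (m p : ℕ) : Fin p × Fin m ≃ Fin p × Fin m :=
  finProdFinEquiv.trans ((finCongr (Nat.mul_comm p m)).trans
    (finProdFinEquiv.symm.trans (Equiv.prodComm (Fin m) (Fin p))))

theorem enumSwap_val (x : Fin p × Fin m) :
    ((enumSwap m p x).2 : ℕ) * p + ((enumSwap m p x).1 : ℕ) = (x.2 : ℕ) + m * (x.1 : ℕ) := by
  have h : finProdFinEquiv (enumSwap m p x).swap =
      finCongr (Nat.mul_comm p m) (finProdFinEquiv x) := by
    rw [← Equiv.apply_symm_apply finProdFinEquiv (finCongr _ _)]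
    rfl
  have h' := congrArg Fin.val h
  simp only [finProdFinEquiv_apply_val, finCongr_apply, Fin.val_cast, Prod.fst_swap,
    Prod.snd_swap] at h'
  rw [← h', Nat.mul_comm, Nat.add_comm]

/-- Hermitian matrices whose spectra are the interlaced sublists of the combined spectrum. -/
theorem exists_sum_conj_eq_sum (hm : 0 < m) (hp : 0 < p) {A : Fin m → Matrix (Fin p) (Fin p) ℂ}
    (hA : ∀ i, (A i).IsHermitian) {γ : ℕ → ℝ}
    (hγmono : ∀ a b, 1 ≤ a → a ≤ b → b ≤ m * p → γ b ≤ γ a)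
    {W : Matrix (Fin p × Fin m) (Fin p × Fin m) ℂ} (hW : Wᴴ * W = 1)
    (hAW : blockDiagonal (fun i => A i) =
      W * diagonal (fun x => ((γ ((x.2 : ℕ) * p + (x.1 : ℕ) + 1) : ℝ) : ℂ)) * Wᴴ) :
    ∃ U : Fin m → Matrix (Fin p) (Fin p) ℂ, (∀ i, (U i)ᴴ * U i = 1) ∧
      ∑ i, U i * diagonal (fun k : Fin p => (γ ((i : ℕ) + 1 + m * (k : ℕ)) : ℂ)) * (U i)ᴴ =
        ∑ i, A i := by
  obtain ⟨F, hF, hF'⟩ := exists_unitary_norm_eq hm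
  obtain ⟨γ₀, hγ₀⟩ : ∃ γ₀ : Fin p × Fin m → ℝ, ∀ x, γ₀ x = γ ((x.2 : ℕ) + 1 + m * (x.1 : ℕ)) :=
    ⟨_, fun _ => rfl⟩
  obtain ⟨V, hV⟩ : ∃ V, V = W.submatrix id (enumSwap m p) := ⟨_, rfl⟩
  have hVV : Vᴴ * V = 1 := by
    rw [hV, conjTranspose_submatrix, ← submatrix_mul _ _ _ _ _ Function.bijective_id, hW,
      submatrix_one_equiv]
  have hdiag : diagonal (fun x => (γ₀ x : ℂ)) =
      (diagonal fun x : Fin p × Fin m => ((γ ((x.2 : ℕ) * p + (x.1 : ℕ) + 1) : ℝ) : ℂ)).submatrix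
        (enumSwap m p) (enumSwap m p) := by
    rw [submatrix_diagonal_equiv]
    congr 1
    funext x
    rw [Function.comp_apply, hγ₀, enumSwap_val, Nat.add_right_comm]
  have hAV : blockDiagonal (fun i => A i) = V * diagonal (fun x => (γ₀ x : ℂ)) * Vᴴ := by
    rw [hAW, hV, hdiag, conjTranspose_submatrix, submatrix_mul_equiv, submatrix_mul_equiv,
      submatrix_id_id]
  obtain ⟨G, hG⟩ : ∃ G, G = blockTransform (p := p) F * V := ⟨_, rfl⟩
  have hGG : Gᴴ * G = 1 := by
    rw [hG, conjTranspose_mul, Matrix.mul_assoc, ← Matrix.mul_assoc _ _ V,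
      blockTransform_conjTranspose_mul hF, Matrix.one_mul, hVV]
  have hGC : ∀ j a b, (G * diagonal (fun x => (γ₀ x : ℂ)) * Gᴴ) (j, a) (j, b) =
      (∑ i, A i) a b / m := by
    intro j a b
    rw [← blockTransform_conj_blockDiagonal_apply hF' A j a b, hAV, hG, conjTranspose_mul]
    simp only [Matrix.mul_assoc]
  have htr : (∑ i, A i).trace = ∑ x, (γ₀ x : ℂ) := by
    rw [trace_sum, ← trace_blockDiagonal, hAV, trace_conj_of_conjTranspose_mul_eq_one hVV,
      trace_diagonal]
  have hC : (∑ i, A i)ᴴ = ∑ i, A i := by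
    rw [conjTranspose_sum]
    exact Finset.sum_congr rfl fun i _ => hA i
  have hmono : ∀ x y, finProdFinEquiv x < finProdFinEquiv y → γ₀ y ≤ γ₀ x := by
    intro x y hxy
    rw [hγ₀, hγ₀]
    have hy := (finProdFinEquiv y).isLt
    rw [Fin.lt_def, finProdFinEquiv_apply_val, finProdFinEquiv_apply_val] at hxy
    rw [finProdFinEquiv_apply_val, Nat.mul_comm p m] at hy
    exact hγmono _ _ (by omega) (by omega) (by omega)
  obtain ⟨U, hU, hUC⟩ := exists_sum_conj_eq hm hp hF hF' hC γ₀ hmono htr hGG hGC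
  exact ⟨U, hU, by simpa only [hγ₀] using hUC⟩

end Matrix

theorem stmt13 (m p : ℕ) (hm : 0 < m) (hp : 0 < p)
    (A : Fin m → Matrix (Fin p) (Fin p) ℂ) (γ : ℕ → ℝ)
    (hA : ∀ i, (A i).IsHermitian)
    (hγmono : ∀ a b, 1 ≤ a → a ≤ b → b ≤ m * p → γ b ≤ γ a)
    (hcomb : HasEigs (Matrix.blockDiagonal (fun i => A i))
      (fun x : Fin p × Fin m => γ ((x.2 : ℕ) * p + (x.1 : ℕ) + 1))) :
    ∃ A' : Fin m → Matrix (Fin p) (Fin p) ℂ,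
      (∑ i, A' i) = (∑ i, A i) ∧
      ∀ i : Fin m, HasEigs (A' i) (fun k : Fin p => γ ((i : ℕ) + 1 + m * (k : ℕ))) := by
  obtain ⟨W, -, hW, hAW⟩ := hcomb
  obtain ⟨U, hU, hUA⟩ := Matrix.exists_sum_conj_eq_sum hm hp hA hγmono hW hAW
  exact ⟨_, hUA, fun i => ⟨U i, mul_eq_one_comm.1 (hU i), hU i, rfl⟩⟩
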